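/- arXiv:2507.10735 — 2 statements merged into one kernel-verified Lean document; each statement's English description precedes it below -/
import Mathlib

section
/- Low demand uncertainty case, optimal value: Let h ∈ H₂ and suppose r ≤ Δ_{s*,1}/(h'(1) − (1−β)). Then the worst-case risk equals ρ_h^wc(μ,σ) = −μ(p−c) + p·σ·Δ_{s*,1}. -/
open MeasureTheory Set

namespace NV

noncomputable section

/-- `hD h u`: the left derivative of `h` at `u` for `u ≠ 0`, and the right derivative at `0`. -/
def hD (h : ℝ → ℝ) (u : ℝ) : ℝ :=
  if u = 0 then derivWithin h (Set.Ioi (0 : ℝ)) 0 else derivWithin h (Set.Iio u) u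

/-- A distortion function: nondecreasing on `[0,1]` with `h 0 = 0`, `h 1 = 1`. -/
def IsDistortion (h : ℝ → ℝ) : Prop :=
  MonotoneOn h (Set.Icc (0 : ℝ) 1) ∧ h 0 = 0 ∧ h 1 = 1

/-- Membership in `H₂`: a convex distortion function with square-integrable derivative. -/
def MemH2 (h : ℝ → ℝ) : Prop :=
  IsDistortion h ∧ ConvexOn ℝ (Set.Icc (0 : ℝ) 1) h ∧
    IntegrableOn (fun u => (hD h u) ^ 2) (Set.Ioo (0 : ℝ) 1)

/-- Value-at-risk of `X` at level `α` under `P`. -/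
def VaR {Ω : Type*} [MeasurableSpace Ω] (P : Measure Ω) (X : Ω → ℝ) (α : ℝ) : ℝ :=
  sInf {t : ℝ | α ≤ (P {ω | X ω ≤ t}).toReal}

/-- Distortion functional `ρ_h(X) = ∫₀¹ VaR_u(X) h'(u) du`. -/
def rho {Ω : Type*} [MeasurableSpace Ω] (h : ℝ → ℝ) (P : Measure Ω) (X : Ω → ℝ) : ℝ :=
  ∫ u in Set.Ioo (0 : ℝ) 1, VaR P X u * hD h u

/-- Loss of ordering `x`: `ψ(x,p,c) = p·max{−S,−x} + c·x`, as a function of demand `s`. -/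
def loss (p c x s : ℝ) : ℝ := p * max (-s) (-x) + c * x

/-- Distributions on `[0,∞)` with mean `μ` and second moment `μ² + σ²`. -/
def momentSet (μ σ : ℝ) : Set (Measure ℝ) :=
  {P | IsProbabilityMeasure P ∧ P (Set.Iio (0 : ℝ)) = 0 ∧
      (∫ s, s ∂P) = μ ∧ (∫ s, s ^ 2 ∂P) = μ ^ 2 + σ ^ 2}

/-- Inner worst-case risk `sup_{F ∈ S(μ,σ)} ρ_h^F(ψ(x,p,c))` at order quantity `x`. -/
def wcInner (h : ℝ → ℝ) (p c μ σ x : ℝ) : ℝ :=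
  sSup ((fun P => rho h P (loss p c x)) '' momentSet μ σ)

/-- Worst-case risk `ρ_h^wc(μ,σ) = inf_{x ≥ 0} sup_{F ∈ S(μ,σ)} ρ_h^F(ψ(x,p,c))`. -/
def wcRisk (h : ℝ → ℝ) (p c μ σ : ℝ) : ℝ :=
  sInf ((fun x => wcInner h p c μ σ x) '' Set.Ici (0 : ℝ))

/-- Generalized inverse `s* = h⁻¹(β)`. -/
def sstar (h : ℝ → ℝ) (β : ℝ) : ℝ := sInf {u ∈ Set.Icc (0 : ℝ) 1 | β ≤ h u}

/-- `Δ_{s,t} = sqrt(t ∫_s^t h'(u)² du − (h(t) − β)²)`. -/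
def Del (h : ℝ → ℝ) (β s t : ℝ) : ℝ :=
  Real.sqrt (t * (∫ u in Set.Ioc s t, (hD h u) ^ 2) - (h t - β) ^ 2)

/-- `σ_t = sqrt(t (μ² + σ²) − μ²)`. -/
def sigt (μ σ t : ℝ) : ℝ := Real.sqrt (t * (μ ^ 2 + σ ^ 2) - μ ^ 2)

/-- `h_s(u) = (h(u) − h(s))/(1 − h(s))` for `s < u ≤ 1`, and `0` otherwise. -/
def hsub (h : ℝ → ℝ) (s u : ℝ) : ℝ :=
  if s < u ∧ u ≤ 1 then (h u - h s) / (1 - h s) else 0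

/-- `k_{s,t}`. -/
def kst (h : ℝ → ℝ) (μ σ s t : ℝ) : ℝ :=
  sigt μ σ t /
    Real.sqrt (t * (∫ u in Set.Ioc (0 : ℝ) t, (hD (hsub h s) u) ^ 2) - (hsub h s t) ^ 2)

/-- `ℓ_{s,t}`. -/
def lst (h : ℝ → ℝ) (μ σ s t : ℝ) : ℝ :=
  -(μ / t) - kst h μ σ s t * hsub h s t / t

/-- The feasible region `D`. -/
def Dset (h : ℝ → ℝ) (μ σ : ℝ) : Set (ℝ × ℝ) :=
  {q | 0 ≤ q.1 ∧ q.1 ≤ q.2 ∧ q.2 ≤ 1 ∧ μ ^ 2 / (μ ^ 2 + σ ^ 2) ≤ q.2 ∧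
      kst h μ σ q.1 q.2 * hD (hsub h q.1) q.2 + lst h μ σ q.1 q.2 ≤ 0}

/-- `g_x(s,t)`. -/
def gfun (h : ℝ → ℝ) (μ σ x : ℝ) (q : ℝ × ℝ) : ℝ :=
  -(h q.1) * x - (μ / q.2) * (h q.2 - h q.1) +
    (sigt μ σ q.2 / q.2) *
      Real.sqrt (q.2 * (∫ u in Set.Ioc q.1 q.2, (hD h u) ^ 2) - (h q.2 - h q.1) ^ 2)

/-- `t*`: the largest `t ∈ [1/(1+r²),1]` satisfying the defining inequality. -/
def tstar (h : ℝ → ℝ) (β r : ℝ) : ℝ :=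
  sSup {t ∈ Set.Icc (1 / (1 + r ^ 2)) (1 : ℝ) |
    (1 + r ^ 2) * (t * hD h t - h t + β) ^ 2 -
      (∫ u in Set.Ioo (0 : ℝ) 1, (hD h u - h t + β) ^ 2) ≤ 0}

end

end NV

namespace NV

open Filter Topology ProbabilityTheory

lemma VaR_le_iff {Ω : Type*} [MeasurableSpace Ω] (P : Measure Ω) [IsProbabilityMeasure P]
    {X : Ω → ℝ} (hX : Measurable X) {u : ℝ} (h0 : 0 < u) (h1 : u < 1) (t : ℝ) :
    VaR P X u ≤ t ↔ u ≤ (P {ω | X ω ≤ t}).toReal := by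
  have : IsProbabilityMeasure (P.map X) := Measure.isProbabilityMeasure_map hX.aemeasurable
  have hC : ∀ t, (P {ω | X ω ≤ t}).toReal = cdf (P.map X) t := by
    intro t
    rw [cdf_eq_real, measureReal_def, Measure.map_apply hX measurableSet_Iic]
    rfl
  simp only [VaR, hC]
  set C := cdf (P.map X)
  obtain ⟨a, ha⟩ := ((tendsto_cdf_atTop (P.map X)).eventually (lt_mem_nhds h1)).exists
  obtain ⟨b, hb⟩ := ((tendsto_cdf_atBot (P.map X)).eventually (gt_mem_nhds h0)).exists
  have hne : {t : ℝ | u ≤ C t}.Nonempty := ⟨a, ha.le⟩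
  have hbd : BddBelow {t : ℝ | u ≤ C t} := by
    refine ⟨b, fun t ht => ?_⟩
    by_contra! hlt
    have h2 := monotone_cdf (P.map X) hlt.le
    exact absurd (le_trans ht h2) (not_le.2 hb)
  refine ⟨fun h => ?_, fun h => csInf_le hbd h⟩
  refine le_trans ?_ (monotone_cdf (P.map X) h)
  have hr := (C.right_continuous (sInf {t : ℝ | u ≤ C t})).mono Set.Ioi_subset_Ici_self
  refine ge_of_tendsto hr ?_
  filter_upwards [self_mem_nhdsWithin] with t ht
  obtain ⟨y, hy, hyt⟩ := exists_lt_of_csInf_lt hne ht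
  exact le_trans hy (monotone_cdf (P.map X) hyt.le)

lemma VaR_monotoneOn {Ω : Type*} [MeasurableSpace Ω] (P : Measure Ω) [IsProbabilityMeasure P]
    {X : Ω → ℝ} (hX : Measurable X) : MonotoneOn (VaR P X) (Set.Ioo 0 1) := by
  intro u hu v hv huv
  rw [VaR_le_iff P hX hu.1 hu.2]
  exact huv.trans ((VaR_le_iff P hX hv.1 hv.2 _).1 le_rfl)

lemma VaR_comp {Ω : Type*} [MeasurableSpace Ω] (P : Measure Ω) [IsProbabilityMeasure P]
    {X : Ω → ℝ} (hX : Measurable X) {φ : ℝ → ℝ} (hm : Monotone φ) (hc : Continuous φ)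
    {u : ℝ} (h0 : 0 < u) (h1 : u < 1) : VaR P (fun ω => φ (X ω)) u = φ (VaR P X u) := by
  have hφX : Measurable fun ω => φ (X ω) := hc.measurable.comp hX
  apply le_antisymm
  · rw [VaR_le_iff P hφX h0 h1]
    refine ((VaR_le_iff P hX h0 h1 _).1 le_rfl).trans ?_
    exact ENNReal.toReal_mono (measure_ne_top _ _) (measure_mono fun ω hω => hm hω)
  · by_contra! hlt
    have hev : ∀ᶠ q in 𝓝[<] (VaR P X u), VaR P (fun ω => φ (X ω)) u < φ q :=
      (hc.tendsto _ |>.eventually (lt_mem_nhds hlt)).filter_mono nhdsWithin_le_nhds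
    obtain ⟨q, hq, hqlt⟩ := (hev.and self_mem_nhdsWithin).exists
    refine absurd ((VaR_le_iff P hX h0 h1 q).2 ?_) (not_le.2 hqlt)
    refine ((VaR_le_iff P hφX h0 h1 _).1 le_rfl).trans ?_
    refine ENNReal.toReal_mono (measure_ne_top _ _) (measure_mono fun ω hω => ?_)
    by_contra hlt'
    exact absurd (hq.trans_le (hm (not_le.1 hlt').le)) (not_lt.2 hω)

instance isProbabilityMeasure_restrict_unit :
    IsProbabilityMeasure (volume.restrict (Set.Ioo (0 : ℝ) 1)) := ⟨by simp⟩

lemma aemeasurable_VaR {Ω : Type*} [MeasurableSpace Ω] (P : Measure Ω) [IsProbabilityMeasure P]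
    {X : Ω → ℝ} (hX : Measurable X) :
    AEMeasurable (VaR P X) (volume.restrict (Set.Ioo (0 : ℝ) 1)) :=
  aemeasurable_restrict_of_monotoneOn measurableSet_Ioo (VaR_monotoneOn P hX)

lemma map_VaR {Ω : Type*} [MeasurableSpace Ω] (P : Measure Ω) [IsProbabilityMeasure P]
    {X : Ω → ℝ} (hX : Measurable X) :
    (volume.restrict (Set.Ioo (0 : ℝ) 1)).map (VaR P X) = P.map X := by
  have hae := aemeasurable_VaR P hX
  have : IsProbabilityMeasure ((volume.restrict (Set.Ioo (0 : ℝ) 1)).map (VaR P X)) :=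
    Measure.isProbabilityMeasure_map hae
  refine Measure.ext_of_Iic _ _ fun t => ?_
  rw [Measure.map_apply_of_aemeasurable hae measurableSet_Iic,
    Measure.map_apply hX measurableSet_Iic, Measure.restrict_apply' measurableSet_Ioo]
  have hp : P (X ⁻¹' Set.Iic t) = ENNReal.ofReal (P (X ⁻¹' Set.Iic t)).toReal :=
    (ENNReal.ofReal_toReal (measure_ne_top _ _)).symm
  have hle : (P (X ⁻¹' Set.Iic t)).toReal ≤ 1 :=
    ENNReal.toReal_le_of_le_ofReal zero_le_one (by simpa using prob_le_one)
  have key : ∀ u, 0 < u → u < 1 → (VaR P X u ≤ t ↔ u ≤ (P (X ⁻¹' Set.Iic t)).toReal) :=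
    fun u h0 h1 => VaR_le_iff P hX h0 h1 t
  rw [hp]
  set C := (P (X ⁻¹' Set.Iic t)).toReal
  apply le_antisymm
  · refine (measure_mono (t := Set.Ioc 0 C) ?_).trans (by simp)
    rintro u ⟨hu, hu0, hu1⟩
    exact ⟨hu0, (key u hu0 hu1).1 hu⟩
  · refine le_trans (by simp) (measure_mono (s := Set.Ioo 0 C) ?_)
    rintro u ⟨hu0, huC⟩
    exact ⟨(key u hu0 (huC.trans_le hle)).2 huC.le, hu0, huC.trans_le hle⟩

lemma lipschitz_of_convex {h : ℝ → ℝ} (hH : MemH2 h) (hM : 0 < hD h 1) :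
    LipschitzOnWith (hD h 1).toNNReal h (Set.Icc 0 1) := by
  obtain ⟨⟨hmono, h0, h1⟩, hconv, -⟩ := hH
  have hd1 : hD h 1 = derivWithin h (Set.Iio 1) 1 := by simp [hD]
  have hdiff : DifferentiableWithinAt ℝ h (Set.Iio 1) 1 := by
    by_contra hcon
    rw [hd1, derivWithin_zero_of_not_differentiableWithinAt hcon] at hM
    exact lt_irrefl _ hM
  have key : ∀ x ∈ Set.Icc (0 : ℝ) 1, ∀ y ∈ Set.Icc (0 : ℝ) 1, x < y →
      h y - h x ≤ hD h 1 * (y - x) := by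
    intro x hx y hy hxy
    have hx1 : x < 1 := hxy.trans_le hy.2
    have hs : slope h x y ≤ slope h x 1 :=
      hconv.slope_mono hx ⟨hy, hxy.ne'⟩ ⟨⟨zero_le_one, le_rfl⟩, hx1.ne'⟩ hy.2
    have hs' := hconv.slope_le_leftDeriv hx ⟨zero_le_one, le_rfl⟩ hx1 hdiff
    rw [← hd1] at hs'
    have := hs.trans hs'
    rwa [slope_def_field, div_le_iff₀ (sub_pos.2 hxy)] at this
  refine LipschitzOnWith.of_dist_le_mul fun x hx y hy => ?_
  rw [Real.coe_toNNReal _ hM.le, Real.dist_eq, Real.dist_eq]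
  rcases lt_trichotomy x y with hxy | rfl | hxy
  · rw [abs_sub_comm, abs_sub_comm x, abs_of_nonneg (sub_nonneg.2 (hmono hx hy hxy.le)),
      abs_of_pos (sub_pos.2 hxy)]
    exact key x hx y hy hxy
  · simp
  · rw [abs_of_nonneg (sub_nonneg.2 (hmono hy hx hxy.le)), abs_of_pos (sub_pos.2 hxy)]
    exact key y hy x hx hxy

/-- A monotone extension of the density `hD h` from `(0, 1)` to the real line. -/
lemma exists_monotone_density {h : ℝ → ℝ} (hH : MemH2 h) (hM : 0 < hD h 1) :
    ∃ G : ℝ → ℝ, Monotone G ∧ (∀ u, 0 ≤ G u) ∧ (∀ u, G u ≤ hD h 1) ∧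
      (∀ u ∈ Set.Ioo (0 : ℝ) 1, G u = hD h u) ∧
      ∀ a ∈ Set.Icc (0 : ℝ) 1, ∫ u in Set.Ioo a 1, G u = 1 - h a := by
  have hlip := lipschitz_of_convex hH hM
  obtain ⟨⟨hmono, h0, h1⟩, hconv, -⟩ := hH
  have hd : ∀ u, 0 < u → hD h u = derivWithin h (Set.Iio u) u := fun u hu => by
    simp [hD, hu.ne']
  have hint : ∀ u ∈ Set.Ioo (0 : ℝ) 1, u ∈ interior (Set.Icc (0 : ℝ) 1) := fun u hu => by
    rwa [interior_Icc]
  have hnn : ∀ u ∈ Set.Ioo (0 : ℝ) 1, 0 ≤ hD h u := by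
    intro u hu
    have := hconv.slope_le_leftDeriv_of_mem_interior (x := 0) (y := u) (by simp) (hint u hu) hu.1
    rw [← hd u hu.1] at this
    refine le_trans ?_ this
    rw [slope_def_field]
    refine div_nonneg (sub_nonneg.2 (hmono (by simp) ⟨hu.1.le, hu.2.le⟩ hu.1.le)) ?_
    linarith [hu.1]
  have hle : ∀ u ∈ Set.Ioo (0 : ℝ) 1, hD h u ≤ hD h 1 := by
    intro u hu
    rw [hd u hu.1]
    refine (hconv.leftDeriv_le_rightDeriv_of_mem_interior (hint u hu)).trans ?_
    refine (hconv.rightDeriv_le_slope_of_mem_interior (y := 1) (hint u hu) (by simp) hu.2).trans ?_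
    rw [slope_def_field, div_le_iff₀ (sub_pos.2 hu.2)]
    have := hlip.dist_le_mul 1 (by simp) u ⟨hu.1.le, hu.2.le⟩
    rw [Real.coe_toNNReal _ hM.le, Real.dist_eq, Real.dist_eq,
      abs_of_pos (sub_pos.2 hu.2)] at this
    exact (le_abs_self _).trans this
  have hmo : ∀ u ∈ Set.Ioo (0 : ℝ) 1, ∀ v ∈ Set.Ioo (0 : ℝ) 1, u ≤ v → hD h u ≤ hD h v := by
    intro u hu v hv huv
    rw [hd u hu.1, hd v hv.1]
    exact hconv.monotoneOn_leftDeriv (hint u hu) (hint v hv) huv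
  have hG : ∀ u ∈ Set.Ioo (0 : ℝ) 1,
      (if u ≤ 0 then 0 else if u < 1 then hD h u else hD h 1) = hD h u := by
    intro u hu
    rw [if_neg (not_le.2 hu.1), if_pos hu.2]
  refine ⟨fun u => if u ≤ 0 then 0 else if u < 1 then hD h u else hD h 1, ?_, ?_, ?_, hG, ?_⟩
  · intro u v huv
    dsimp only
    split_ifs with a b c d e f
    · exact le_rfl
    · exact hnn v ⟨not_le.1 b, c⟩
    · exact hM.le
    · linarith
    · exact hmo u ⟨not_le.1 a, d⟩ v ⟨not_le.1 e, f⟩ huv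
    · exact hle u ⟨not_le.1 a, d⟩
    · linarith
    · linarith
    · exact le_rfl
  · intro u
    dsimp only
    split_ifs with a b
    · exact le_rfl
    · exact hnn u ⟨not_le.1 a, b⟩
    · exact hM.le
  · intro u
    dsimp only
    split_ifs with a b
    · exact hM.le
    · exact hle u ⟨not_le.1 a, b⟩
    · exact le_rfl
  · intro a ha
    have hac : AbsolutelyContinuousOnInterval h a 1 := by
      refine (hlip.mono ?_).absolutelyContinuousOnInterval
      rw [Set.uIcc_of_le ha.2]
      exact Set.Icc_subset_Icc_left ha.1
    have hftc := hac.integral_deriv_eq_sub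
    rw [h1, intervalIntegral.integral_of_le ha.2, integral_Ioc_eq_integral_Ioo] at hftc
    rw [← hftc]
    refine setIntegral_congr_ae measurableSet_Ioo ?_
    filter_upwards [hac.ae_differentiableAt] with u hu hmem
    have hu01 : u ∈ Set.Ioo (0 : ℝ) 1 := ⟨ha.1.trans_lt hmem.1, hmem.2⟩
    rw [hG u hu01, hd u hu01.1]
    refine (hu ?_).derivWithin (uniqueDiffWithinAt_Iio u)
    rw [Set.uIcc_of_le ha.2]
    exact ⟨hmem.1.le, hmem.2.le⟩

lemma sstar_spec {h : ℝ → ℝ} (hcont : ContinuousOn h (Set.Icc 0 1))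
    (hmono : MonotoneOn h (Set.Icc 0 1))
    (h0 : h 0 = 0) (h1 : h 1 = 1) {β : ℝ} (hβ0 : 0 < β) (hβ1 : β < 1) :
    sstar h β ∈ Set.Ioo (0 : ℝ) 1 ∧ h (sstar h β) = β := by
  have hcl : IsClosed {u ∈ Set.Icc (0 : ℝ) 1 | β ≤ h u} :=
    hcont.preimage_isClosed_of_isClosed isClosed_Icc isClosed_Ici
  have hbd : BddBelow {u ∈ Set.Icc (0 : ℝ) 1 | β ≤ h u} := ⟨0, fun u hu => hu.1.1⟩
  have hmem : sstar h β ∈ {u ∈ Set.Icc (0 : ℝ) 1 | β ≤ h u} :=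
    hcl.csInf_mem ⟨1, by simp, by rw [h1]; exact hβ1.le⟩ hbd
  obtain ⟨v, hv, hvβ⟩ := intermediate_value_Icc zero_le_one hcont
    (show β ∈ Set.Icc (h 0) (h 1) by rw [h0, h1]; exact ⟨hβ0.le, hβ1.le⟩)
  have hle : sstar h β ≤ v := csInf_le hbd ⟨hv, hvβ.ge⟩
  have heq : h (sstar h β) = β :=
    le_antisymm ((hmono hmem.1 hv hle).trans hvβ.le) hmem.2
  refine ⟨⟨lt_of_le_of_ne hmem.1.1 ?_, lt_of_le_of_ne hmem.1.2 ?_⟩, heq⟩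
  · intro hs
    rw [← hs, h0] at heq
    exact hβ0.ne heq
  · intro hs
    rw [hs, h1] at heq
    exact hβ1.ne' heq

/-- The uniform distribution on `(0, 1)`. -/
noncomputable abbrev uniformUnit : Measure ℝ := volume.restrict (Set.Ioo (0 : ℝ) 1)

lemma quantile_moments {μ σ : ℝ} (hμ : 0 < μ) (hσ : 0 < σ) {P : Measure ℝ}
    (hP : P ∈ momentSet μ σ) :
    Integrable (VaR P (fun s => -s)) uniformUnit ∧
      Integrable (fun u => VaR P (fun s => -s) u ^ 2) uniformUnit ∧
      ∫ u, VaR P (fun s => -s) u ∂uniformUnit = -μ ∧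
      ∫ u, VaR P (fun s => -s) u ^ 2 ∂uniformUnit = μ ^ 2 + σ ^ 2 := by
  obtain ⟨hprob, -, hm1, hm2⟩ := hP
  have hi1 : Integrable (fun s : ℝ => s) P :=
    Integrable.of_integral_ne_zero (by rw [hm1]; exact hμ.ne')
  have hi2 : Integrable (fun s : ℝ => s ^ 2) P :=
    Integrable.of_integral_ne_zero (by rw [hm2]; positivity)
  have hX : Measurable fun s : ℝ => -s := measurable_neg
  have hQ := aemeasurable_VaR P hX
  have hmap := map_VaR P hX
  have hid : ∀ ν : Measure ℝ, AEStronglyMeasurable (fun s : ℝ => s) ν :=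
    fun ν => measurable_id.aestronglyMeasurable
  have hsq : ∀ ν : Measure ℝ, AEStronglyMeasurable (fun s : ℝ => s ^ 2) ν :=
    fun ν => (measurable_id.pow_const 2).aestronglyMeasurable
  refine ⟨?_, ?_, ?_, ?_⟩
  · have : Integrable (fun s : ℝ => s) (P.map fun s : ℝ => -s) :=
      (integrable_map_measure (hid _) hX.aemeasurable).2 hi1.neg
    rw [← hmap, integrable_map_measure (hid _) hQ] at this
    exact this
  · have : Integrable (fun s : ℝ => s ^ 2) (P.map fun s : ℝ => -s) := by
      rw [integrable_map_measure (hsq _) hX.aemeasurable]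
      simpa [Function.comp_def] using hi2
    rw [← hmap, integrable_map_measure (hsq _) hQ] at this
    exact this
  · rw [← integral_map (f := fun s : ℝ => s) hQ (hid _), hmap,
      integral_map hX.aemeasurable (hid _), integral_neg, hm1]
  · rw [← integral_map (f := fun s : ℝ => s ^ 2) hQ (hsq _), hmap,
      integral_map hX.aemeasurable (hsq _)]
    simpa using hm2

lemma rho_loss {h G : ℝ → ℝ} (hG : ∀ u ∈ Set.Ioo (0 : ℝ) 1, G u = hD h u) {p : ℝ} (hp : 0 ≤ p)
    (c x : ℝ) (P : Measure ℝ) [IsProbabilityMeasure P] :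
    rho h P (loss p c x) =
      ∫ u, (p * max (VaR P (fun s => -s) u) (-x) + c * x) * G u ∂uniformUnit := by
  refine setIntegral_congr_fun measurableSet_Ioo fun u hu => ?_
  have hm : Monotone fun q : ℝ => p * max q (-x) + c * x := fun a b hab =>
    add_le_add_left (mul_le_mul_of_nonneg_left (max_le_max_right _ hab) hp) _
  have hc : Continuous fun q : ℝ => p * max q (-x) + c * x := by fun_prop
  have := VaR_comp P (X := fun s : ℝ => -s) measurable_neg hm hc hu.1 hu.2
  rw [hG u hu, ← this]
  rfl

lemma integrable_of_monotone_bdd {ν : Measure ℝ} [IsFiniteMeasure ν] {g : ℝ → ℝ} {M : ℝ}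
    (hg : Monotone g) (h0 : ∀ u, 0 ≤ g u) (hM : ∀ u, g u ≤ M) : Integrable g ν :=
  Integrable.of_bound hg.measurable.aestronglyMeasurable M
    (ae_of_all _ fun u => by rw [Real.norm_eq_abs, abs_of_nonneg (h0 u)]; exact hM u)

lemma integrable_sq_of_monotone_bdd {ν : Measure ℝ} [IsFiniteMeasure ν] {g : ℝ → ℝ} {M : ℝ}
    (hg : Monotone g) (h0 : ∀ u, 0 ≤ g u) (hM : ∀ u, g u ≤ M) :
    Integrable (fun u => g u ^ 2) ν :=
  integrable_of_monotone_bdd (M := M ^ 2) (fun _ _ hab => pow_le_pow_left₀ (h0 _) (hg hab) 2)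
    (fun _ => sq_nonneg _) (fun u => pow_le_pow_left₀ (h0 u) (hM u) 2)

lemma integrable_loss_mul {ν : Measure ℝ} [IsFiniteMeasure ν] {Q G : ℝ → ℝ} {M : ℝ}
    (hQ : Integrable Q ν) (hG : Monotone G) (h0 : ∀ u, 0 ≤ G u) (hM : ∀ u, G u ≤ M)
    (p c x : ℝ) : Integrable (fun u => (p * max (Q u) (-x) + c * x) * G u) ν := by
  refine Integrable.mul_bdd (c := M) ?_ hG.measurable.aestronglyMeasurable
    (ae_of_all _ fun u => by rw [Real.norm_eq_abs, abs_of_nonneg (h0 u)]; exact hM u)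
  exact ((hQ.sup (integrable_const (-x))).const_mul p).add (integrable_const _)

lemma integral_linear_combination {ν : Measure ℝ} [IsProbabilityMeasure ν] {a b g₁ g₂ e : ℝ → ℝ}
    (ha : Integrable a ν) (hb : Integrable b ν) (hg₁ : Integrable g₁ ν) (hg₂ : Integrable g₂ ν)
    (he : Integrable e ν) (A B C D E K : ℝ) :
    Integrable (fun u => A * a u + B * b u + C * g₁ u + D * g₂ u + E * e u + K) ν ∧
    ∫ u, (A * a u + B * b u + C * g₁ u + D * g₂ u + E * e u + K) ∂ν =
      A * (∫ u, a u ∂ν) + B * (∫ u, b u ∂ν) + C * (∫ u, g₁ u ∂ν) + D * (∫ u, g₂ u ∂ν) +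
        E * (∫ u, e u ∂ν) + K := by
  have i1 := ha.const_mul A
  have i2 := i1.add (hb.const_mul B)
  have i3 := i2.add (hg₁.const_mul C)
  have i4 := i3.add (hg₂.const_mul D)
  have i5 := i4.add (he.const_mul E)
  refine ⟨i5.add (integrable_const K), ?_⟩
  have e6 := integral_add i5 (integrable_const K)
  have e5 := integral_add i4 (he.const_mul E)
  have e4 := integral_add i3 (hg₂.const_mul D)
  have e3 := integral_add i2 (hg₁.const_mul C)
  have e2 := integral_add i1 (hb.const_mul B)
  simp only [Pi.add_apply] at e2 e3 e4 e5 e6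
  rw [e6, e5, e4, e3, e2]
  simp [integral_const_mul]

/-- Lagrangian bound for the truncated quantile, with multipliers `1 / (2k)` and `η`. -/
lemma max_mul_le_lagrangian {k η gs : ℝ} (hk : 0 < k) (q : ℝ) {G g : ℝ} (hG : 0 ≤ G)
    (hg : (g = G ∧ gs ≤ G) ∨ (g = 0 ∧ G ≤ gs)) :
    max q (-(k * (η - gs / 2))) * G ≤ 1 / (2 * k) * q ^ 2 + η * q +
      (k * (η - gs / 2) - k * η) * g + k / 2 * g ^ 2 + (-(k * (η - gs / 2))) * G +
        k / 2 * η ^ 2 := by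
  have hA : 1 / (2 * k) * q ^ 2 + η * q + k / 2 * η ^ 2 = (q + k * η) ^ 2 / (2 * k) := by
    field_simp
    ring
  have hA0 : 0 ≤ (q + k * η) ^ 2 / (2 * k) := by positivity
  have hB : q * G ≤ (q + k * η) ^ 2 / (2 * k) + k / 2 * (G ^ 2 - 2 * G * η) := by
    have : (q + k * η) ^ 2 / (2 * k) + k / 2 * (G ^ 2 - 2 * G * η) - q * G =
        (q + k * η - k * G) ^ 2 / (2 * k) := by
      field_simp
      ring
    have h2 : 0 ≤ (q + k * η - k * G) ^ 2 / (2 * k) := by positivity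
    linarith
  have hkG : 0 ≤ k * G := by positivity
  rcases hg with ⟨rfl, hle⟩ | ⟨rfl, hle⟩
  · have h3 := mul_nonneg hkG (sub_nonneg.2 hle)
    rcases max_choice q (-(k * (η - gs / 2))) with hm | hm <;> rw [hm] <;> nlinarith
  · have h3 := mul_nonneg hkG (sub_nonneg.2 hle)
    rcases max_choice q (-(k * (η - gs / 2))) with hm | hm <;> rw [hm] <;> nlinarith

lemma integral_loss_le {p c μ σ k m D M s : ℝ} {Q G g : ℝ → ℝ} (hp : 0 < p) (hm : m = 1 - c / p)
    (hk : 0 < k) (hkD : k * D = σ)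
    (hGm : Monotone G) (hG0 : ∀ u, 0 ≤ G u) (hGM : ∀ u, G u ≤ M)
    (hgdef : g = (Set.Ioi s).indicator G)
    (hg : Integrable g uniformUnit) (hg2 : Integrable (fun u => g u ^ 2) uniformUnit)
    (hG1 : ∫ u, G u ∂uniformUnit = 1) (hg1 : ∫ u, g u ∂uniformUnit = m)
    (hgD : ∫ u, g u ^ 2 ∂uniformUnit = D ^ 2 + m ^ 2)
    (hQ : Integrable Q uniformUnit) (hQ2 : Integrable (fun u => Q u ^ 2) uniformUnit)
    (hQ1 : ∫ u, Q u ∂uniformUnit = -μ) (hQσ : ∫ u, Q u ^ 2 ∂uniformUnit = μ ^ 2 + σ ^ 2) :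
    ∫ u, (p * max (Q u) (-(k * (m + μ / k - G s / 2))) + c * (k * (m + μ / k - G s / 2))) * G u
      ∂uniformUnit ≤ p * (-μ * m + σ * D) := by
  set η := m + μ / k with hη
  set x := k * (η - G s / 2) with hx
  have hGi : Integrable G uniformUnit := integrable_of_monotone_bdd hGm hG0 hGM
  obtain ⟨hi, he⟩ := integral_linear_combination hQ2 hQ hg hg2 hGi (p * (1 / (2 * k))) (p * η)
    (p * (x - k * η)) (p * (k / 2)) (p * (-x) + c * x) (p * (k / 2 * η ^ 2))
  refine (integral_mono (integrable_loss_mul hQ hGm hG0 hGM p c x) hi fun u => ?_).trans ?_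
  · have hcase : (g u = G u ∧ G s ≤ G u) ∨ (g u = 0 ∧ G u ≤ G s) := by
      rw [hgdef]
      by_cases hu : s < u
      · exact Or.inl ⟨Set.indicator_of_mem (Set.mem_Ioi.2 hu) _, hGm hu.le⟩
      · exact Or.inr ⟨Set.indicator_of_notMem (by simpa using hu) _, hGm (not_lt.1 hu)⟩
    have := mul_le_mul_of_nonneg_left
      (max_mul_le_lagrangian (η := η) hk (Q u) (hG0 u) hcase) hp.le
    rw [← hx] at this
    dsimp only
    linarith
  · rw [he, hQσ, hQ1, hg1, hgD, hG1]
    have hc : c = p * (1 - m) := by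
      rw [hm]
      field_simp
      ring
    have hηk : k * η = k * m + μ := by
      rw [hη]
      field_simp
    apply le_of_eq
    rw [hc, ← hkD, hη]
    field_simp
    ring

lemma integral_loss_ge {p c μ σ k m D M s x : ℝ} {Q G g : ℝ → ℝ} (hp : 0 < p) (hm : m = 1 - c / p)
    (hkD : k * D = σ)
    (hGm : Monotone G) (hG0 : ∀ u, 0 ≤ G u) (hGM : ∀ u, G u ≤ M)
    (hgdef : g = (Set.Ioi s).indicator G)
    (hg : Integrable g uniformUnit) (hg2 : Integrable (fun u => g u ^ 2) uniformUnit)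
    (hG1 : ∫ u, G u ∂uniformUnit = 1) (hg1 : ∫ u, g u ∂uniformUnit = m)
    (hgD : ∫ u, g u ^ 2 ∂uniformUnit = D ^ 2 + m ^ 2)
    (hQ : Integrable Q uniformUnit)
    (hQge : ∀ᵐ u ∂uniformUnit, -μ + k * (g u - m) ≤ Q u) :
    p * (-μ * m + σ * D) ≤ ∫ u, (p * max (Q u) (-x) + c * x) * G u ∂uniformUnit := by
  have hGi : Integrable G uniformUnit := integrable_of_monotone_bdd hGm hG0 hGM
  obtain ⟨hi, he⟩ := integral_linear_combination hg hg hg hg2 hGi (p * (-μ)) (p * (-(k * m)))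
    (p * x) (p * k) (p * (-x) + c * x) 0
  refine le_trans (le_of_eq ?_)
    (integral_mono_ae hi (integrable_loss_mul hQ hGm hG0 hGM p c x) ?_)
  · have hc : c = p * (1 - m) := by
      rw [hm]
      field_simp
      ring
    rw [he, hg1, hgD, hG1, hc, ← hkD]
    ring
  · filter_upwards [hQge] with u hu
    have hpG : 0 ≤ p * G u := mul_nonneg hp.le (hG0 u)
    have h1 := mul_le_mul_of_nonneg_left (hu.trans (le_max_left _ (-x))) hpG
    have h2 := mul_le_mul_of_nonneg_left (le_max_right (Q u) (-x)) hpG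
    have hcase : g u = G u ∨ g u = 0 := by
      rw [hgdef]
      exact Set.indicator_eq_zero_or_self _ _ _ |>.symm
    rcases hcase with hgu | hgu <;> rw [hgu] at h1 ⊢ <;> linarith

/-- The quantile of the law of a monotone function of a uniform variable dominates the function. -/
lemma ae_le_VaR_neg {q : ℝ → ℝ} (hq : Monotone q) :
    ∀ᵐ u ∂uniformUnit, q u ≤ VaR (uniformUnit.map fun u => -q u) (fun s => -s) u := by
  have hmeas : Measurable fun u => -q u := hq.measurable.neg
  have : IsProbabilityMeasure (uniformUnit.map fun u => -q u) :=
    Measure.isProbabilityMeasure_map hmeas.aemeasurable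
  have hcount : ∀ᵐ u ∂uniformUnit, ContinuousAt q u :=
    ae_restrict_of_ae (ae_iff.2 (hq.countable_not_continuousAt.measure_zero _))
  filter_upwards [hcount, ae_restrict_mem measurableSet_Ioo] with u hcu hu
  set t := VaR (uniformUnit.map fun u => -q u) (fun s => -s) u with ht
  have hut := (VaR_le_iff (uniformUnit.map fun u => -q u) measurable_neg hu.1 hu.2 t).1 ht.ge
  rw [Measure.map_apply hmeas (measurableSet_le measurable_neg measurable_const),
    Measure.restrict_apply' measurableSet_Ioo] at hut
  have hlt : ∀ v < u, q v ≤ t := by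
    intro v hv
    by_contra! hcon
    have hsub : ((fun u => -q u) ⁻¹' {s : ℝ | -s ≤ t}) ∩ Set.Ioo 0 1 ⊆ Set.Ioo 0 v := by
      rintro w ⟨hw, hw0, -⟩
      refine ⟨hw0, ?_⟩
      by_contra! hvw
      have h1 : q w ≤ t := by simpa using hw
      exact absurd (hcon.trans_le (hq hvw)) (not_lt.2 h1)
    have h2 := hut.trans (ENNReal.toReal_mono (by simp) (measure_mono hsub))
    rw [Real.volume_Ioo, sub_zero, ENNReal.toReal_ofReal'] at h2
    rcases le_max_iff.1 h2 with h3 | h3 <;> linarith [hu.1]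
  have htend : Filter.Tendsto q (nhdsWithin u (Set.Iio u)) (nhds (q u)) :=
    hcu.tendsto.mono_left nhdsWithin_le_nhds
  refine le_of_tendsto htend ?_
  filter_upwards [self_mem_nhdsWithin] with v hv using hlt v hv

lemma map_mem_momentSet {μ σ k m D : ℝ} {g : ℝ → ℝ} (hgm : Monotone g) (hkD : k * D = σ)
    (hneg : ∀ u, k * (g u - m) ≤ μ)
    (hg : Integrable g uniformUnit) (hg2 : Integrable (fun u => g u ^ 2) uniformUnit)
    (hg1 : ∫ u, g u ∂uniformUnit = m)
    (hgD : ∫ u, g u ^ 2 ∂uniformUnit = D ^ 2 + m ^ 2) :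
    uniformUnit.map (fun u => -(-μ + k * (g u - m))) ∈ momentSet μ σ := by
  have hmeas : Measurable fun u => -(-μ + k * (g u - m)) :=
    (((hgm.measurable.sub_const m).const_mul k).const_add (-μ)).neg
  refine ⟨Measure.isProbabilityMeasure_map hmeas.aemeasurable, ?_, ?_, ?_⟩
  · rw [Measure.map_apply hmeas measurableSet_Iio]
    convert measure_empty (μ := uniformUnit)
    ext u
    simp only [Set.mem_preimage, Set.mem_Iio, Set.mem_empty_iff_false, iff_false, not_lt]
    linarith [hneg u]
  · rw [integral_map (f := fun s : ℝ => s) hmeas.aemeasurable measurable_id.aestronglyMeasurable]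
    have := (integral_linear_combination hg hg hg hg hg (-k) 0 0 0 0 (μ + k * m)).2
    rw [hg1] at this
    calc _ = _ := integral_congr_ae (ae_of_all _ fun u => by ring)
      _ = _ := this
      _ = μ := by ring
  · rw [integral_map (f := fun s : ℝ => s ^ 2) hmeas.aemeasurable
      (measurable_id.pow_const 2).aestronglyMeasurable]
    have := (integral_linear_combination hg hg2 hg hg hg (-2 * k * (μ + k * m)) (k ^ 2) 0 0 0
      ((μ + k * m) ^ 2)).2
    rw [hg1, hgD] at this
    calc _ = _ := integral_congr_ae (ae_of_all _ fun u => by ring)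
      _ = _ := this
      _ = μ ^ 2 + σ ^ 2 := by rw [← hkD]; ring

lemma bddAbove_rho {h G : ℝ → ℝ} (hG : ∀ u ∈ Set.Ioo (0 : ℝ) 1, G u = hD h u) {p c M μ σ x : ℝ}
    (hμ : 0 < μ) (hσ : 0 < σ) (hp : 0 < p) (hc : 0 < c) (hx : 0 ≤ x)
    (hGm : Monotone G) (hG0 : ∀ u, 0 ≤ G u) (hGM : ∀ u, G u ≤ M) :
    BddAbove ((fun P => rho h P (loss p c x)) '' momentSet μ σ) := by
  refine ⟨p * M * (μ ^ 2 + σ ^ 2) + (p * (1 + x) + c * x) * M, ?_⟩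
  rintro _ ⟨P, hP, rfl⟩
  have := hP.1
  obtain ⟨hQ, hQ2, -, hQσ⟩ := quantile_moments hμ hσ hP
  obtain ⟨hi, he⟩ := integral_linear_combination hQ2 hQ2 hQ2 hQ2 hQ2 (p * M) 0 0 0 0
    ((p * (1 + x) + c * x) * M)
  dsimp only
  rw [rho_loss hG hp.le]
  refine (integral_mono (integrable_loss_mul hQ hGm hG0 hGM p c x) hi fun u => ?_).trans ?_
  · set Q := VaR P (fun s => -s) u
    have hmax : max Q (-x) ≤ Q ^ 2 + 1 + x :=
      max_le (by nlinarith [sq_nonneg (Q - 1)]) (by nlinarith [sq_nonneg Q])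
    have hcx : 0 ≤ c * x := by positivity
    have h1 : p * max Q (-x) + c * x ≤ p * (Q ^ 2 + 1 + x) + c * x := by
      linarith [mul_le_mul_of_nonneg_left hmax hp.le]
    have h2 : 0 ≤ p * (Q ^ 2 + 1 + x) + c * x := by positivity
    calc _ ≤ (p * (Q ^ 2 + 1 + x) + c * x) * G u := mul_le_mul_of_nonneg_right h1 (hG0 u)
      _ ≤ (p * (Q ^ 2 + 1 + x) + c * x) * M := mul_le_mul_of_nonneg_left (hGM u) h2
      _ = _ := by ring
  · rw [he, hQσ]
    linarith

end NV
open NV MeasureTheory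
/-- Low demand uncertainty case: the optimal value. -/
theorem stmt1 (p c μ σ : ℝ) (hc : 0 < c) (hcp : c < p) (hμ : 0 < μ) (hσ : 0 < σ)
    (h : ℝ → ℝ) (hH2 : MemH2 h)
    (hr : σ / μ ≤ Del h (c / p) (sstar h (c / p)) 1 / (hD h 1 - (1 - c / p))) :
    wcRisk h p c μ σ = -μ * (p - c) + p * σ * Del h (c / p) (sstar h (c / p)) 1 := by
  have hp : 0 < p := hc.trans hcp
  have hβ0 : 0 < c / p := div_pos hc hp
  have hβ1 : c / p < 1 := (div_lt_one hp).2 hcp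
  set s := sstar h (c / p) with hs
  set D := Del h (c / p) s 1 with hDdef
  set M := hD h 1 with hMdef
  obtain ⟨m, hm⟩ : ∃ m, m = 1 - c / p := ⟨_, rfl⟩
  rw [← hm] at hr
  have hm0 : 0 < m := by linarith
  have hD0 : 0 ≤ D := Real.sqrt_nonneg _
  have hratio : 0 < D / (M - m) := (div_pos hσ hμ).trans_le hr
  have hMm : 0 < M - m := by
    by_contra! hcon
    exact absurd hratio (not_lt.2 (div_nonpos_of_nonneg_of_nonpos hD0 hcon))
  have hDpos : 0 < D := lt_of_le_of_ne hD0 fun h0 => by simp [← h0] at hratio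
  have hM : 0 < hD h 1 := by linarith
  obtain ⟨G, hGm, hG0, hGM, hG, hGint⟩ := exists_monotone_density hH2 hM
  have hlip := lipschitz_of_convex hH2 hM
  obtain ⟨⟨hmono, h0, h1⟩, -, -⟩ := hH2
  obtain ⟨hs01, hhs⟩ := sstar_spec hlip.continuousOn hmono h0 h1 hβ0 hβ1
  rw [← hs] at hs01 hhs
  obtain ⟨g, hgdef⟩ : ∃ g, g = (Set.Ioi s).indicator G := ⟨_, rfl⟩
  have hgm : Monotone g := by
    intro u v huv
    rw [hgdef]
    by_cases hu : s < u
    · rw [Set.indicator_of_mem (Set.mem_Ioi.2 hu),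
        Set.indicator_of_mem (Set.mem_Ioi.2 (hu.trans_le huv))]
      exact hGm huv
    · rw [Set.indicator_of_notMem (by simpa using hu)]
      exact Set.indicator_nonneg (fun w _ => hG0 w) v
  have hg0 : ∀ u, 0 ≤ g u := fun u => hgdef ▸ Set.indicator_nonneg (fun w _ => hG0 w) u
  have hgM : ∀ u, g u ≤ M := fun u =>
    hgdef ▸ (Set.indicator_le_self' (fun w _ => hG0 w) u).trans (hGM u)
  have hg : Integrable g uniformUnit := integrable_of_monotone_bdd hgm hg0 hgM
  have hg2 : Integrable (fun u => g u ^ 2) uniformUnit :=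
    integrable_sq_of_monotone_bdd hgm hg0 hgM
  have hG1 : ∫ u, G u ∂uniformUnit = 1 := by
    rw [hGint 0 (by simp), h0, sub_zero]
  have hinter : Set.Ioo (0 : ℝ) 1 ∩ Set.Ioi s = Set.Ioo s 1 := by
    ext u
    simp only [Set.mem_inter_iff, Set.mem_Ioo, Set.mem_Ioi]
    exact ⟨fun hu => ⟨hu.2, hu.1.2⟩, fun hu => ⟨⟨hs01.1.trans hu.1, hu.2⟩, hu.1⟩⟩
  have hg1 : ∫ u, g u ∂uniformUnit = m := by
    rw [hgdef, setIntegral_indicator measurableSet_Ioi, hinter,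
      hGint s ⟨hs01.1.le, hs01.2.le⟩, hhs, hm]
  have hgD : ∫ u, g u ^ 2 ∂uniformUnit = D ^ 2 + m ^ 2 := by
    have e1 : ∫ u, g u ^ 2 ∂uniformUnit = ∫ u in Set.Ioc s 1, hD h u ^ 2 := by
      have : (fun u => g u ^ 2) = (Set.Ioi s).indicator fun u => G u ^ 2 := by
        funext u
        rw [hgdef]
        by_cases hu : u ∈ Set.Ioi s <;> simp [hu]
      rw [this, setIntegral_indicator measurableSet_Ioi, hinter, integral_Ioc_eq_integral_Ioo]
      refine setIntegral_congr_fun measurableSet_Ioo fun u hu => ?_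
      rw [hG u ⟨hs01.1.trans hu.1, hu.2⟩]
    have e2 : D ^ 2 = 1 * (∫ u in Set.Ioc s 1, hD h u ^ 2) - (h 1 - c / p) ^ 2 :=
      Real.sq_sqrt (Real.sqrt_pos.1 hDpos).le
    rw [e1, e2, h1, hm]
    ring
  obtain ⟨k, hk⟩ : ∃ k, k = σ / D := ⟨_, rfl⟩
  have hk0 : 0 < k := hk ▸ div_pos hσ hDpos
  have hkD : k * D = σ := by rw [hk]; field_simp
  have hkM : k * (M - m) ≤ μ := by
    rw [div_le_div_iff₀ hμ hMm] at hr
    rw [hk, div_mul_eq_mul_div, div_le_iff₀ hDpos]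
    linarith
  have hval : -μ * (p - c) + p * σ * D = p * (-μ * m + σ * D) := by
    rw [hm]
    field_simp
  rw [hval]
  have hF : uniformUnit.map (fun u => -(-μ + k * (g u - m))) ∈ momentSet μ σ :=
    map_mem_momentSet hgm hkD (fun u =>
      (mul_le_mul_of_nonneg_left (sub_le_sub_right (hgM u) m) hk0.le).trans hkM) hg hg2 hg1 hgD
  have hlower : ∀ x, 0 ≤ x → p * (-μ * m + σ * D) ≤ wcInner h p c μ σ x := by
    intro x hx
    refine le_csSup_of_le (bddAbove_rho hG hμ hσ hp hc hx hGm hG0 hGM) ⟨_, hF, rfl⟩ ?_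
    have := hF.1
    dsimp only
    rw [rho_loss hG hp.le]
    refine integral_loss_ge hp hm hkD hGm hG0 hGM hgdef hg hg2 hG1 hg1 hgD
      (quantile_moments hμ hσ hF).1 (ae_le_VaR_neg fun u v huv => ?_)
    linarith [mul_le_mul_of_nonneg_left (hgm huv) hk0.le]
  apply le_antisymm
  · have hx : 0 ≤ k * (m + μ / k - G s / 2) := by
      have h2 : k * (m + μ / k) = k * m + μ := by field_simp
      nlinarith [hGM s, mul_le_mul_of_nonneg_left (hGM s) hk0.le, mul_pos hk0 hm0]
    refine csInf_le_of_le ⟨p * (-μ * m + σ * D), ?_⟩ ⟨_, hx, rfl⟩ ?_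
    · rintro _ ⟨x, hx, rfl⟩
      exact hlower x hx
    · refine csSup_le ⟨_, _, hF, rfl⟩ ?_
      rintro _ ⟨P, hP, rfl⟩
      have := hP.1
      obtain ⟨hQ, hQ2, hQ1, hQσ⟩ := quantile_moments hμ hσ hP
      dsimp only
      rw [rho_loss hG hp.le]
      exact integral_loss_le hp hm hk0 hkD hGm hG0 hGM hgdef hg hg2 hG1 hg1 hgD hQ hQ2 hQ1 hQσ
  · refine le_csInf ⟨_, 0, Set.self_mem_Ici, rfl⟩ ?_
    rintro _ ⟨x, hx, rfl⟩
    exact hlower x hx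
end

section
/- Multi-product separability (Theorem 2): Let h be a convex distortion function, and for i = 1,…,n let pᵢ > cᵢ > 0, μᵢ, σᵢ > 0. Let S(μ⃗,σ⃗) be the set of joint distributions F of S⃗ = (S₁,…,Sₙ) on [0,∞)ⁿ with E^F[Sᵢ] = μᵢ and Var^F(Sᵢ) = σᵢ² for each i, and define the multi-product worst-case risk ρ_h^wc(μ⃗,σ⃗) = inf_{x⃗ ∈ [0,∞)ⁿ} sup_{F ∈ S(μ⃗,σ⃗)} ρ_h^F(Σᵢ ψᵢ(xᵢ,pᵢ,cᵢ)), where ψᵢ(x,pᵢ,cᵢ) = pᵢ·max{−Sᵢ,−x} + cᵢ·x. Then ρ_h^wc(μ⃗,σ⃗) = Σᵢ ρ_h^wc(μᵢ,σᵢ), where ρ_h^wc(μᵢ,σᵢ) is the single-product worst-case risk with parameters (pᵢ,cᵢ,μᵢ,σᵢ); moreover the vector (x₁*,…,xₙ*) of single-product optimal order quantities attains the outer infimum. -/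
open MeasureTheory Set

open NV MeasureTheory
namespace NV

noncomputable section

/-- Joint distributions on `[0,∞)ⁿ` with marginal means `μᵢ` and variances `σᵢ²`. -/
def momentSetN (n : ℕ) (μv σv : Fin n → ℝ) : Set (Measure (Fin n → ℝ)) :=
  {P | IsProbabilityMeasure P ∧ (∀ i, P {s | s i < 0} = 0) ∧
      (∀ i, (∫ s, s i ∂P) = μv i) ∧ (∀ i, (∫ s, (s i - μv i) ^ 2 ∂P) = (σv i) ^ 2)}

/-- Multi-product inner worst-case risk for the order vector `xv`. -/
def wcInnerN (n : ℕ) (h : ℝ → ℝ) (pv cv μv σv xv : Fin n → ℝ) : ℝ :=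
  sSup ((fun P : Measure (Fin n → ℝ) =>
    rho h P (fun s => ∑ i, loss (pv i) (cv i) (xv i) (s i))) '' momentSetN n μv σv)

/-- Multi-product worst-case risk `ρ_h^wc(μ⃗,σ⃗)`. -/
def wcRiskN (n : ℕ) (h : ℝ → ℝ) (pv cv μv σv : Fin n → ℝ) : ℝ :=
  sInf ((fun xv => wcInnerN n h pv cv μv σv xv) '' {xv : Fin n → ℝ | ∀ i, 0 ≤ xv i})

end

end NV

namespace NV

/-- Lebesgue measure on the open unit interval. -/
noncomputable abbrev unitVol : Measure ℝ := volume.restrict (Set.Ioo (0 : ℝ) 1)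

instance : IsProbabilityMeasure unitVol := ⟨by simp⟩

lemma hD_monotoneOn {h : ℝ → ℝ} (hconv : ConvexOn ℝ (Set.Icc (0 : ℝ) 1) h) :
    MonotoneOn (hD h) (Set.Ioo 0 1) := by
  have := hconv.monotoneOn_leftDeriv
  rw [interior_Icc] at this
  refine this.congr fun u hu => ?_
  simp [hD, hu.1.ne']

lemma IsDistortion.hD_nonneg {h : ℝ → ℝ} (hdist : IsDistortion h)
    (hconv : ConvexOn ℝ (Set.Icc (0 : ℝ) 1) h) {u : ℝ} (hu : u ∈ Set.Ioo (0 : ℝ) 1) :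
    0 ≤ hD h u := by
  have h0 : (0 : ℝ) ∈ Set.Icc (0 : ℝ) 1 := by simp
  have hslope := hconv.slope_le_leftDeriv_of_mem_interior h0 (by rwa [interior_Icc]) hu.1
  have hle := hdist.1 h0 (Set.Ioo_subset_Icc_self hu) hu.1.le
  rw [hD, if_neg hu.1.ne']
  refine le_trans ?_ hslope
  rw [slope_def_field]
  exact div_nonneg (sub_nonneg.2 hle) (sub_nonneg.2 hu.1.le)

lemma IsDistortion.integrable_hD {h : ℝ → ℝ} (hdist : IsDistortion h) :
    Integrable (hD h) unitVol := by
  have hmono : MonotoneOn h (Set.uIcc 0 1) := by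
    rw [Set.uIcc_of_le zero_le_one]; exact hdist.1
  have hint := hmono.intervalIntegrable_deriv
  rw [intervalIntegrable_iff_integrableOn_Ioo_of_le zero_le_one] at hint
  refine Integrable.congr hint ?_
  have hdiff := hdist.1.ae_differentiableWithinAt_of_mem
  filter_upwards [ae_restrict_mem measurableSet_Ioo, ae_restrict_of_ae hdiff] with u hu hdu
  have hd : DifferentiableAt ℝ h u :=
    (hdu (Set.Ioo_subset_Icc_self hu)).differentiableAt (Icc_mem_nhds hu.1 hu.2)
  rw [hD, if_neg hu.1.ne']
  exact (hd.derivWithin (uniqueDiffWithinAt_Iio u)).symm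

lemma VaR_map {Ω : Type*} [MeasurableSpace Ω] {P : Measure Ω} {X : Ω → ℝ}
    (hX : AEMeasurable X P) : VaR (P.map X) id = VaR P X := by
  funext α
  have (t : ℝ) : (P.map X) {s | id s ≤ t} = P {ω | X ω ≤ t} :=
    Measure.map_apply_of_aemeasurable hX measurableSet_Iic
  simp only [VaR, this]

lemma VaR_id_le_iff (Q : Measure ℝ) [IsProbabilityMeasure Q] {u : ℝ}
    (hu : u ∈ Set.Ioo (0 : ℝ) 1) (t : ℝ) :
    VaR Q id u ≤ t ↔ u ≤ ProbabilityTheory.cdf Q t := by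
  have hset : {t : ℝ | u ≤ (Q {ω | id ω ≤ t}).toReal} = {t | u ≤ ProbabilityTheory.cdf Q t} := by
    ext t
    rw [Set.mem_ofPred_eq, Set.mem_ofPred_eq, ProbabilityTheory.cdf_eq_real]
    rfl
  rw [VaR, hset]
  have hbot : ∃ b, ProbabilityTheory.cdf Q b < u :=
    ((ProbabilityTheory.tendsto_cdf_atBot Q).eventually (gt_mem_nhds hu.1)).exists
  have htop : ∃ b, u < ProbabilityTheory.cdf Q b :=
    ((ProbabilityTheory.tendsto_cdf_atTop Q).eventually (lt_mem_nhds hu.2)).exists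
  obtain ⟨b, hb⟩ := hbot
  obtain ⟨d, hd⟩ := htop
  have hbdd : BddBelow {t | u ≤ ProbabilityTheory.cdf Q t} := by
    refine ⟨b, fun x hx => ?_⟩
    by_contra! hxb
    exact absurd (hx.trans (ProbabilityTheory.monotone_cdf Q hxb.le)) (not_le.2 hb)
  refine ⟨fun hle => ?_, fun hle => csInf_le hbdd hle⟩
  have hgt : ∀ s, t < s → u ≤ ProbabilityTheory.cdf Q s := by
    intro s hs
    obtain ⟨r, hr, hrs⟩ := exists_lt_of_csInf_lt ⟨d, hd.le⟩ (hle.trans_lt hs)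
    exact le_trans hr (ProbabilityTheory.monotone_cdf Q hrs.le)
  have hcont := ((ProbabilityTheory.cdf Q).right_continuous t).mono Set.Ioi_subset_Ici_self
  exact ge_of_tendsto hcont.tendsto
    (Filter.eventually_of_mem self_mem_nhdsWithin fun s hs => hgt s hs)

section Law

variable {Ω : Type*} [MeasurableSpace Ω] {P : Measure Ω} [IsProbabilityMeasure P] {X : Ω → ℝ}

lemma VaR_le_iff_s13 (hX : AEMeasurable X P) {u : ℝ} (hu : u ∈ Set.Ioo (0 : ℝ) 1) (t : ℝ) :
    VaR P X u ≤ t ↔ u ≤ P.real {ω | X ω ≤ t} := by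
  have := Measure.isProbabilityMeasure_map hX
  rw [← VaR_map hX, VaR_id_le_iff _ hu, ProbabilityTheory.cdf_eq_real,
    map_measureReal_apply_of_aemeasurable hX measurableSet_Iic]
  rfl

lemma VaR_monotoneOn_s13 (hX : AEMeasurable X P) : MonotoneOn (VaR P X) (Set.Ioo 0 1) := by
  intro u hu v hv huv
  rw [VaR_le_iff_s13 hX hu]
  exact huv.trans ((VaR_le_iff_s13 hX hv _).1 le_rfl)

lemma aemeasurable_VaR_s13 (hX : AEMeasurable X P) : AEMeasurable (VaR P X) unitVol :=
  aemeasurable_restrict_of_monotoneOn measurableSet_Ioo (VaR_monotoneOn_s13 hX)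

/-- The quantile function pushes the uniform law forward to the law of the random variable. -/
lemma map_VaR_s13 (hX : AEMeasurable X P) : unitVol.map (VaR P X) = P.map X := by
  have := Measure.isProbabilityMeasure_map hX
  have := Measure.isProbabilityMeasure_map (aemeasurable_VaR_s13 hX)
  refine Measure.ext_of_Iic _ _ fun t => ?_
  rw [Measure.map_apply_of_aemeasurable (aemeasurable_VaR_s13 hX) measurableSet_Iic,
    Measure.map_apply_of_aemeasurable hX measurableSet_Iic,
    Measure.restrict_apply₀' measurableSet_Ioo.nullMeasurableSet]
  have hle : P.real {ω | X ω ≤ t} ≤ 1 := measureReal_le_one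
  have hsub : VaR P X ⁻¹' Set.Iic t ∩ Set.Ioo 0 1 =
      Set.Iic (P.real {ω | X ω ≤ t}) ∩ Set.Ioo 0 1 := by
    ext u
    constructor
    · rintro ⟨h1, h2⟩; exact ⟨(VaR_le_iff_s13 hX h2 t).1 h1, h2⟩
    · rintro ⟨h1, h2⟩; exact ⟨(VaR_le_iff_s13 hX h2 t).2 h1, h2⟩
  have hae : (Set.Iic (P.real {ω | X ω ≤ t}) ∩ Set.Ioo 0 1 : Set ℝ) =ᵐ[volume]
      (Set.Iic (P.real {ω | X ω ≤ t}) ∩ Set.Ioc 0 1 : Set ℝ) :=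
    (Filter.EventuallyEq.refl _ _).inter Ioo_ae_eq_Ioc
  rw [hsub, measure_congr hae, Set.inter_comm, Set.Ioc_inter_Iic, Real.volume_Ioc, sub_zero,
    inf_of_le_right hle, ofReal_measureReal]
  rfl

lemma ae_VaR {p : ℝ → Prop} (hp : MeasurableSet {x | p x}) (hX : AEMeasurable X P) :
    (∀ᵐ u ∂unitVol, p (VaR P X u)) ↔ ∀ᵐ ω ∂P, p (X ω) := by
  rw [← ae_map_iff (aemeasurable_VaR_s13 hX) hp, map_VaR_s13 hX, ae_map_iff hX hp]

lemma integral_comp_VaR {f : ℝ → ℝ} (hf : Measurable f) (hX : AEMeasurable X P) :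
    ∫ u, f (VaR P X u) ∂unitVol = ∫ ω, f (X ω) ∂P := by
  rw [← integral_map (aemeasurable_VaR_s13 hX) hf.aestronglyMeasurable, map_VaR_s13 hX,
    integral_map hX hf.aestronglyMeasurable]

lemma integrable_VaR (hX : Integrable X P) : Integrable (VaR P X) unitVol := by
  have hid : Integrable id (unitVol.map (VaR P X)) := by
    rw [map_VaR_s13 hX.aemeasurable]
    exact (integrable_map_measure aestronglyMeasurable_id hX.aemeasurable).2 hX
  exact (integrable_map_measure aestronglyMeasurable_id (aemeasurable_VaR_s13 hX.aemeasurable)).1 hid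

lemma setIntegral_VaR_le (hX : Integrable X P) (A : Set ℝ) (t : ℝ) :
    ∫ u in A, VaR P X u ∂unitVol ≤ t * unitVol.real A + ∫ ω, max (X ω - t) 0 ∂P := by
  have hV := integrable_VaR hX
  have hVt : Integrable (fun u => VaR P X u - t) unitVol := hV.sub (integrable_const t)
  have hm : Measurable fun x : ℝ => max (x - t) 0 := by fun_prop
  have hpos : Integrable (fun u => max (VaR P X u - t) 0) unitVol := hVt.pos_part
  have h1 : ∫ u in A, VaR P X u ∂unitVol =
      ∫ u in A, (VaR P X u - t) ∂unitVol + t * unitVol.real A := by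
    rw [integral_sub hV.integrableOn (integrable_const t), setIntegral_const, smul_eq_mul]
    ring
  have h2 : ∫ u in A, (VaR P X u - t) ∂unitVol ≤ ∫ u in A, max (VaR P X u - t) 0 ∂unitVol :=
    integral_mono hVt.integrableOn hpos.integrableOn fun u => le_max_left _ _
  have h3 : ∫ u in A, max (VaR P X u - t) 0 ∂unitVol ≤ ∫ u, max (VaR P X u - t) 0 ∂unitVol :=
    setIntegral_le_integral hpos (ae_of_all _ fun u => le_max_right _ _)
  rw [integral_comp_VaR hm hX.aemeasurable] at h3
  linarith

/-- The dual bound of `setIntegral_VaR_le` is attained on upper sets of the unit interval. -/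
lemma exists_setIntegral_VaR_eq (hX : Integrable X P) {C : ℝ} (hC : ∀ᵐ ω ∂P, |X ω| ≤ C)
    {A : Set ℝ} (hA : MeasurableSet A)
    (hup : ∀ u ∈ A, ∀ v ∈ Set.Ioo (0 : ℝ) 1, u ≤ v → v ∈ A) (hA1 : A ⊆ Set.Ioo 0 1) :
    ∃ t, ∫ u in A, VaR P X u ∂unitVol = t * unitVol.real A + ∫ ω, max (X ω - t) 0 ∂P := by
  have hCV : ∀ᵐ u ∂unitVol, |VaR P X u| ≤ C :=
    (ae_VaR (p := fun x => |x| ≤ C) (measurableSet_le (by fun_prop) (by fun_prop))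
      hX.aemeasurable).2 hC
  obtain ⟨t, ht⟩ : ∃ t, ∀ᵐ u ∂unitVol,
      (u ∈ A → t ≤ VaR P X u) ∧ (u ∉ A → VaR P X u ≤ t) := by
    rcases A.eq_empty_or_nonempty with rfl | ⟨a, ha⟩
    · exact ⟨C, hCV.mono fun u hu => ⟨fun h => h.elim, fun _ => (abs_le.1 hu).2⟩⟩
    rcases (Set.Ioo (0 : ℝ) 1 \ A).eq_empty_or_nonempty with he | hne
    · refine ⟨-C, ?_⟩
      filter_upwards [hCV, ae_restrict_mem measurableSet_Ioo] with u hu hu1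
      exact ⟨fun _ => (abs_le.1 hu).1, fun h => (he.subset ⟨hu1, h⟩).elim⟩
    · have hle : ∀ u ∈ A, ∀ v ∈ Set.Ioo (0 : ℝ) 1 \ A, VaR P X v ≤ VaR P X u := by
        intro u hu v hv
        refine VaR_monotoneOn_s13 hX.aemeasurable hv.1 (hA1 hu) ?_
        by_contra! huv
        exact hv.2 (hup u hu v hv.1 huv.le)
      have hbdd : BddAbove (VaR P X '' (Set.Ioo (0 : ℝ) 1 \ A)) :=
        ⟨VaR P X a, Set.forall_mem_image.2 fun v hv => hle a ha v hv⟩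
      refine ⟨sSup (VaR P X '' (Set.Ioo (0 : ℝ) 1 \ A)), ?_⟩
      filter_upwards [ae_restrict_mem measurableSet_Ioo] with u hu1
      exact ⟨fun h => csSup_le (hne.image _) (Set.forall_mem_image.2 fun v hv => hle u h v hv),
        fun h => le_csSup hbdd (Set.mem_image_of_mem _ ⟨hu1, h⟩)⟩
  refine ⟨t, ?_⟩
  have hm : Measurable fun x : ℝ => max (x - t) 0 := by fun_prop
  have hV := integrable_VaR hX
  have hind : ∫ u, max (VaR P X u - t) 0 ∂unitVol = ∫ u in A, (VaR P X u - t) ∂unitVol := by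
    rw [← integral_indicator hA]
    refine integral_congr_ae (ht.mono fun u hu => ?_)
    by_cases huA : u ∈ A
    · simp [huA, hu.1 huA]
    · simp [huA, hu.2 huA]
  rw [← integral_comp_VaR hm hX.aemeasurable, hind,
    integral_sub hV.integrableOn (integrable_const t), setIntegral_const, smul_eq_mul]
  ring

end Law

/-- If `f` has smaller integral than `g` over all upper sets, then it has smaller integral against
every nonnegative nondecreasing weight. -/
lemma integral_mul_le_of_upperSet {f g φ : ℝ → ℝ} {C : ℝ}
    (hφ : MonotoneOn φ (Set.Ioo 0 1)) (hφ0 : ∀ u ∈ Set.Ioo (0 : ℝ) 1, 0 ≤ φ u)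
    (hφi : Integrable φ unitVol) (hf : AEMeasurable f unitVol) (hg : AEMeasurable g unitVol)
    (hfC : ∀ᵐ u ∂unitVol, |f u| ≤ C) (hgC : ∀ᵐ u ∂unitVol, |g u| ≤ C)
    (hle : ∀ A : Set ℝ, MeasurableSet A → A ⊆ Set.Ioo 0 1 →
      (∀ u ∈ A, ∀ v ∈ Set.Ioo (0 : ℝ) 1, u ≤ v → v ∈ A) →
      ∫ u in A, f u ∂unitVol ≤ ∫ u in A, g u ∂unitVol) :
    ∫ u, f u * φ u ∂unitVol ≤ ∫ u, g u * φ u ∂unitVol := by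
  have hφ0' : ∀ᵐ u ∂unitVol, 0 ≤ φ u :=
    (ae_restrict_mem measurableSet_Ioo).mono hφ0
  have hint : ∀ k : ℝ → ℝ, AEMeasurable k unitVol → (∀ᵐ u ∂unitVol, |k u| ≤ C) →
      Integrable k unitVol := fun k hk hkC =>
    Integrable.of_bound hk.aestronglyMeasurable C hkC
  have hmul : ∀ k : ℝ → ℝ, AEMeasurable k unitVol → (∀ᵐ u ∂unitVol, |k u| ≤ C) →
      Integrable (fun u => k u * φ u) unitVol := fun k hk hkC =>
    hφi.bdd_mul hk.aestronglyMeasurable hkC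
  have hAm : ∀ s, MeasurableSet (Set.Ioo 0 1 ∩ {u | s < φ u}) := by
    refine fun s => Set.OrdConnected.measurableSet ⟨fun a ha b hb x hx => ?_⟩
    have hx1 : x ∈ Set.Ioo (0 : ℝ) 1 := ⟨ha.1.1.trans_le hx.1, hx.2.trans_lt hb.1.2⟩
    exact ⟨hx1, lt_of_lt_of_le ha.2 (hφ ha.1 hx1 hx.1)⟩
  have hlayer : ∀ k : ℝ → ℝ, AEMeasurable k unitVol → (∀ᵐ u ∂unitVol, |k u| ≤ C) →
      ENNReal.ofReal (∫ u, (k u + C) * φ u ∂unitVol) =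
        ∫⁻ s in Set.Ioi 0, ENNReal.ofReal
          (∫ u in Set.Ioo 0 1 ∩ {u | s < φ u}, (k u + C) ∂unitVol) := by
    intro k hk hkC
    have hk0 : ∀ᵐ u ∂unitVol, 0 ≤ k u + C := hkC.mono fun u hu => by linarith [(abs_le.1 hu).1]
    have hkm : AEMeasurable (fun u => ENNReal.ofReal (k u + C)) unitVol :=
      (hk.add_const C).ennreal_ofReal
    have hac : unitVol.withDensity (fun u => ENNReal.ofReal (k u + C)) ≪ unitVol :=
      withDensity_absolutelyContinuous _ _
    have hki : Integrable (fun u => (k u + C) * φ u) unitVol := by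
      simp_rw [add_mul]
      exact (hmul k hk hkC).add (hφi.const_mul C)
    rw [ofReal_integral_eq_lintegral_ofReal hki
      (by filter_upwards [hk0, hφ0'] with u h1 h2 using mul_nonneg h1 h2)]
    have h1 : ∫⁻ u, ENNReal.ofReal ((k u + C) * φ u) ∂unitVol =
        ∫⁻ u, ENNReal.ofReal (φ u) ∂(unitVol.withDensity fun u => ENNReal.ofReal (k u + C)) := by
      rw [lintegral_withDensity_eq_lintegral_mul₀ hkm hφi.aemeasurable.ennreal_ofReal]
      exact lintegral_congr_ae (hk0.mono fun u hu => ENNReal.ofReal_mul hu)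
    rw [h1, lintegral_eq_lintegral_meas_lt _ (hac.ae_le hφ0') (hφi.aemeasurable.mono_ac hac)]
    refine lintegral_congr fun s => ?_
    have hAe : {u | s < φ u} =ᵐ[unitVol] (Set.Ioo 0 1 ∩ {u | s < φ u} : Set ℝ) := by
      filter_upwards [ae_restrict_mem measurableSet_Ioo] with u hu
      exact propext ⟨fun h => ⟨hu, h⟩, fun h => h.2⟩
    rw [measure_congr (hac.ae_eq hAe), withDensity_apply _ (hAm s),
      ofReal_integral_eq_lintegral_ofReal]
    · exact ((hint k hk hkC).add (integrable_const C)).integrableOn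
    · exact ae_restrict_of_ae hk0
  have hmain : ∫ u, (f u + C) * φ u ∂unitVol ≤ ∫ u, (g u + C) * φ u ∂unitVol := by
    have hg0 : 0 ≤ ∫ u, (g u + C) * φ u ∂unitVol := by
      refine integral_nonneg_of_ae ?_
      filter_upwards [hgC, hφ0'] with u h1 h2
      exact mul_nonneg (by linarith [(abs_le.1 h1).1]) h2
    rw [← ENNReal.ofReal_le_ofReal_iff hg0, hlayer f hf hfC, hlayer g hg hgC]
    refine lintegral_mono fun s => ENNReal.ofReal_le_ofReal ?_
    rw [integral_add (hint f hf hfC).integrableOn (integrable_const C),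
      integral_add (hint g hg hgC).integrableOn (integrable_const C)]
    exact add_le_add (hle _ (hAm s) Set.inter_subset_left
      fun u hu v hv huv => ⟨hv, lt_of_lt_of_le hu.2 (hφ hu.1 hv huv)⟩) le_rfl
  simp_rw [add_mul] at hmain
  rw [integral_add (hmul f hf hfC) (hφi.const_mul C),
    integral_add (hmul g hg hgC) (hφi.const_mul C)] at hmain
  linarith

lemma rho_map {Ω Ω' : Type*} [MeasurableSpace Ω] [MeasurableSpace Ω'] {P : Measure Ω} {h : ℝ → ℝ}
    {s : Ω → Ω'} (hs : AEMeasurable s P)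
    {X : Ω' → ℝ} (hX : Measurable X) : rho h (P.map s) X = rho h P (fun ω => X (s ω)) := by
  have : VaR (P.map s) X = VaR P (fun ω => X (s ω)) := by
    rw [← VaR_map hX.aemeasurable, AEMeasurable.map_map_of_aemeasurable hX.aemeasurable hs,
      VaR_map (hX.comp_aemeasurable hs)]
    rfl
  simp only [rho, this]

section Rho

variable {Ω ι : Type*} [MeasurableSpace Ω] {P : Measure Ω} [IsProbabilityMeasure P]
  {h : ℝ → ℝ}

lemma IsDistortion.integrable_VaR_mul_hD (hdist : IsDistortion h) {X : Ω → ℝ} {C : ℝ}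
    (hX : AEMeasurable X P) (hC : ∀ᵐ ω ∂P, |X ω| ≤ C) :
    Integrable (fun u => VaR P X u * hD h u) unitVol :=
  hdist.integrable_hD.bdd_mul (aemeasurable_VaR_s13 hX).aestronglyMeasurable
    ((ae_VaR (p := fun x => |x| ≤ C) (measurableSet_le (by fun_prop) (by fun_prop)) hX).2 hC)

/-- Subadditivity of the distortion functional on bounded random variables. -/
lemma rho_sum_le [Fintype ι] (hdist : IsDistortion h)
    (hconv : ConvexOn ℝ (Set.Icc (0 : ℝ) 1) h) {X : ι → Ω → ℝ} {C : ι → ℝ}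
    (hX : ∀ i, AEMeasurable (X i) P) (hC : ∀ i, ∀ᵐ ω ∂P, |X i ω| ≤ C i) :
    rho h P (fun ω => ∑ i, X i ω) ≤ ∑ i, rho h P (X i) := by
  have hXi : ∀ i, Integrable (X i) P := fun i =>
    Integrable.of_bound (hX i).aestronglyMeasurable (C i) (hC i)
  have hS : Integrable (fun ω => ∑ i, X i ω) P := integrable_finsetSum _ fun i _ => hXi i
  have hSC : ∀ᵐ ω ∂P, |∑ i, X i ω| ≤ ∑ i, C i := by
    filter_upwards [ae_all_iff.2 hC] with ω hω
    exact (Finset.abs_sum_le_sum_abs _ _).trans (Finset.sum_le_sum fun i _ => hω i)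
  have hm : ∀ c : ℝ, MeasurableSet {x : ℝ | |x| ≤ c} := fun c =>
    measurableSet_le (by fun_prop) (by fun_prop)
  have hVC : ∀ᵐ u ∂unitVol, |∑ i, VaR P (X i) u| ≤ ∑ i, C i := by
    filter_upwards [ae_all_iff.2 fun i => (ae_VaR (hm (C i)) (hX i)).2 (hC i)] with u hu
    exact (Finset.abs_sum_le_sum_abs _ _).trans (Finset.sum_le_sum fun i _ => hu i)
  have hcmp := integral_mul_le_of_upperSet (f := VaR P fun ω => ∑ i, X i ω)
    (g := fun u => ∑ i, VaR P (X i) u) (hD_monotoneOn hconv)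
    (fun u hu => hdist.hD_nonneg hconv hu) hdist.integrable_hD (aemeasurable_VaR_s13 hS.aemeasurable)
    (Finset.aemeasurable_fun_sum _ fun i _ => aemeasurable_VaR_s13 (hX i))
    ((ae_VaR (hm _) hS.aemeasurable).2 hSC) hVC ?_
  · refine hcmp.trans_eq ?_
    simp_rw [Finset.sum_mul]
    exact integral_finsetSum _ fun i _ => hdist.integrable_VaR_mul_hD (hX i) (hC i)
  · intro A hA hA1 hup
    choose t ht using fun i => exists_setIntegral_VaR_eq (hXi i) (hC i) hA hup hA1
    have hpos : ∀ i, Integrable (fun ω => max (X i ω - t i) 0) P := fun i =>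
      ((hXi i).sub (integrable_const (t i))).pos_part
    rw [integral_finsetSum _ fun i _ => (integrable_VaR (hXi i)).integrableOn]
    simp_rw [ht]
    rw [Finset.sum_add_distrib, ← Finset.sum_mul, ← integral_finsetSum _ fun i _ => hpos i]
    refine (setIntegral_VaR_le hS A (∑ i, t i)).trans (add_le_add_right ?_ _)
    refine integral_mono (hS.sub (integrable_const _)).pos_part
      (integrable_finsetSum _ fun i _ => hpos i) fun ω => ?_
    refine max_le ?_ (Finset.sum_nonneg fun i _ => le_max_right _ _)
    rw [← Finset.sum_sub_distrib]
    exact Finset.sum_le_sum fun i _ => le_max_left _ _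

lemma le_rho (hdist : IsDistortion h) (hconv : ConvexOn ℝ (Set.Icc (0 : ℝ) 1) h) {X : Ω → ℝ}
    {a C : ℝ} (hX : AEMeasurable X P) (hC : ∀ᵐ ω ∂P, |X ω| ≤ C) (ha : ∀ᵐ ω ∂P, a ≤ X ω) :
    a * ∫ u, hD h u ∂unitVol ≤ rho h P X := by
  rw [← integral_const_mul]
  refine integral_mono_ae (hdist.integrable_hD.const_mul a) (hdist.integrable_VaR_mul_hD hX hC) ?_
  filter_upwards [(ae_VaR measurableSet_Ici hX).2 ha, ae_restrict_mem measurableSet_Ioo] with u h1 h2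
  exact mul_le_mul_of_nonneg_right h1 (hdist.hD_nonneg hconv h2)

lemma rho_le (hdist : IsDistortion h) (hconv : ConvexOn ℝ (Set.Icc (0 : ℝ) 1) h) {X : Ω → ℝ}
    {C : ℝ} (hX : AEMeasurable X P) (hC : ∀ᵐ ω ∂P, |X ω| ≤ C) :
    rho h P X ≤ C * ∫ u, hD h u ∂unitVol := by
  rw [← integral_const_mul]
  refine integral_mono_ae (hdist.integrable_VaR_mul_hD hX hC) (hdist.integrable_hD.const_mul C) ?_
  filter_upwards [(ae_VaR measurableSet_Iic hX).2 (hC.mono fun ω hω => (abs_le.1 hω).2),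
    ae_restrict_mem measurableSet_Ioo] with u h1 h2
  exact mul_le_mul_of_nonneg_right h1 (hdist.hD_nonneg hconv h2)

/-- A nondecreasing function of a uniform variable is almost everywhere its own quantile
function. -/
lemma VaR_unitVol_ae_eq {G : ℝ → ℝ} (hG : MonotoneOn G (Set.Ioo 0 1))
    (hGi : Integrable G unitVol) : VaR unitVol G =ᵐ[unitVol] G := by
  have hle : VaR unitVol G ≤ᵐ[unitVol] G := by
    filter_upwards [ae_restrict_mem measurableSet_Ioo] with u hu
    rw [VaR_le_iff_s13 hGi.aemeasurable hu]
    have hsub : unitVol.real (Set.Ioc 0 u) ≤ unitVol.real {v | G v ≤ G u} :=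
      ENNReal.toReal_mono (measure_ne_top _ _) <| measure_mono_ae <| by
        filter_upwards [ae_restrict_mem measurableSet_Ioo] with v hv hvu
        exact hG hv hu hvu.2
    have hval : unitVol.real (Set.Ioc 0 u) = u := by
      have : Set.Ioc 0 u ∩ Set.Ioo 0 1 = Set.Ioc 0 u :=
        Set.inter_eq_left.2 fun v hv => ⟨hv.1, hv.2.trans_lt hu.2⟩
      rw [measureReal_restrict_apply measurableSet_Ioc, this, Real.volume_real_Ioc_of_le hu.1.le,
        sub_zero]
    exact hval.symm.trans_le hsub
  refine (integral_eq_iff_of_ae_le (integrable_VaR hGi) hGi hle).1 ?_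
  exact integral_comp_VaR measurable_id hGi.aemeasurable

/-- Additivity of the distortion functional on comonotonic random variables. -/
lemma rho_unitVol_sum [Fintype ι] (hdist : IsDistortion h) {G : ι → ℝ → ℝ} {C : ι → ℝ}
    (hG : ∀ i, MonotoneOn (G i) (Set.Ioo 0 1)) (hC : ∀ i, ∀ᵐ u ∂unitVol, |G i u| ≤ C i) :
    rho h unitVol (fun u => ∑ i, G i u) = ∑ i, rho h unitVol (G i) := by
  have hm : ∀ i, AEMeasurable (G i) unitVol := fun i =>
    aemeasurable_restrict_of_monotoneOn measurableSet_Ioo (hG i)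
  have hGi : ∀ i, Integrable (G i) unitVol := fun i =>
    Integrable.of_bound (hm i).aestronglyMeasurable (C i) (hC i)
  have hSm : MonotoneOn (fun u => ∑ i, G i u) (Set.Ioo 0 1) := fun u hu v hv huv =>
    Finset.sum_le_sum fun i _ => hG i hu hv huv
  simp only [rho]
  rw [← integral_finsetSum _ fun i _ => hdist.integrable_VaR_mul_hD (hm i) (hC i)]
  refine integral_congr_ae ?_
  filter_upwards [VaR_unitVol_ae_eq hSm (integrable_finsetSum _ fun i _ => hGi i),
    ae_all_iff.2 fun i => VaR_unitVol_ae_eq (hG i) (hGi i)] with u h1 h2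
  simp only [h1, h2, Finset.sum_mul]

end Rho

section Loss

lemma measurable_loss (p c x : ℝ) : Measurable (loss p c x) := by
  unfold loss; fun_prop

lemma loss_antitone {p : ℝ} (hp : 0 ≤ p) (c x : ℝ) : Antitone (loss p c x) := by
  intro s t hst
  unfold loss
  gcongr

lemma abs_loss_le {p c x s : ℝ} (hp : 0 ≤ p) (hc : 0 ≤ c) (hx : 0 ≤ x) (hs : 0 ≤ s) :
    |loss p c x s| ≤ p * x + c * x := by
  have h1 : p * max (-s) (-x) ≤ p * 0 :=
    mul_le_mul_of_nonneg_left (max_le (by linarith) (by linarith)) hp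
  have h2 : p * -x ≤ p * max (-s) (-x) := mul_le_mul_of_nonneg_left (le_max_right _ _) hp
  have h3 := mul_nonneg hc hx
  have h4 := mul_nonneg hp hx
  rw [loss, abs_le]
  constructor <;> linarith

lemma neg_mul_le_loss {p c x s : ℝ} (hp : 0 ≤ p) (hc : 0 ≤ c) (hx : 0 ≤ x) :
    -(p * s) ≤ loss p c x s := by
  have h2 : p * -s ≤ p * max (-s) (-x) := mul_le_mul_of_nonneg_left (le_max_left _ _) hp
  have h3 := mul_nonneg hc hx
  rw [loss]
  linarith

end Loss

section Moments

lemma integral_sq_eq_iff {P : Measure ℝ} [IsProbabilityMeasure P] {μ σ : ℝ} (hμ : μ ≠ 0)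
    (hσ : σ ≠ 0) (hmean : ∫ s, s ∂P = μ) :
    ∫ s, s ^ 2 ∂P = μ ^ 2 + σ ^ 2 ↔ ∫ s, (s - μ) ^ 2 ∂P = σ ^ 2 := by
  have h1 : Integrable (fun s : ℝ => s) P := by
    by_contra hn
    exact hμ (hmean.symm.trans (integral_undef hn))
  have hlin : ∀ a b : ℝ, Integrable (fun s => a * s + b) P := fun a b =>
    (h1.const_mul a).add (integrable_const b)
  have key : Integrable (fun s => s ^ 2) P →
      ∫ s, (s - μ) ^ 2 ∂P = ∫ s, s ^ 2 ∂P - μ ^ 2 := by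
    intro h2
    have : ∀ s : ℝ, (s - μ) ^ 2 = s ^ 2 + (-2 * μ * s + μ ^ 2) := fun s => by ring
    simp_rw [this]
    rw [integral_add h2 (hlin _ _), integral_add (h1.const_mul _) (integrable_const _),
      integral_const_mul, hmean]
    simp
    ring
  constructor
  · intro h
    have h2 : Integrable (fun s => s ^ 2) P := by
      by_contra hn
      rw [integral_undef hn] at h
      have := sq_pos_of_ne_zero hμ
      nlinarith [sq_nonneg σ]
    rw [key h2, h]
    ring
  · intro h
    have h2 : Integrable (fun s => (s - μ) ^ 2) P := by
      by_contra hn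
      rw [integral_undef hn] at h
      exact hσ (pow_eq_zero_iff two_ne_zero |>.1 h.symm)
    have h3 : Integrable (fun s => s ^ 2) P := by
      refine (h2.add (hlin (2 * μ) (-μ ^ 2))).congr (ae_of_all _ fun s => ?_)
      simp only [Pi.add_apply]
      ring
    have := key h3
    linarith

/-- The moment set contains a law with bounded support. -/
lemma exists_mem_momentSet {μ σ : ℝ} (hμ : 0 < μ) :
    ∃ P ∈ momentSet μ σ, ∃ M, ∀ᵐ s ∂P, s ≤ M := by
  set M := (μ ^ 2 + σ ^ 2) / μ with hM
  set w := μ ^ 2 / (μ ^ 2 + σ ^ 2) with hw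
  have hden : 0 < μ ^ 2 + σ ^ 2 := by positivity
  have hM0 : 0 ≤ M := by positivity
  have hw0 : 0 ≤ w := by positivity
  have hw1 : 0 ≤ 1 - w := by
    rw [sub_nonneg, hw, div_le_one hden]
    nlinarith [sq_nonneg σ]
  have hint : ∀ f : ℝ → ℝ, ∫ s, f s ∂(ENNReal.ofReal (1 - w) • Measure.dirac 0 +
      ENNReal.ofReal w • Measure.dirac M) = (1 - w) * f 0 + w * f M := by
    intro f
    have hi : ∀ a : ℝ, Integrable f (Measure.dirac a) := fun a =>
      integrable_dirac (by simp)
    rw [integral_add_measure ((hi 0).smul_measure ENNReal.ofReal_ne_top)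
      ((hi M).smul_measure ENNReal.ofReal_ne_top), integral_smul_measure, integral_smul_measure,
      integral_dirac, integral_dirac, ENNReal.toReal_ofReal hw1, ENNReal.toReal_ofReal hw0]
    rfl
  refine ⟨ENNReal.ofReal (1 - w) • Measure.dirac 0 + ENNReal.ofReal w • Measure.dirac M,
    ⟨⟨?_⟩, ?_, ?_, ?_⟩, M, ?_⟩
  · simp [← ENNReal.ofReal_add hw1 hw0]
  · simp [hM0.not_gt]
  · rw [hint]
    rw [hw, hM]
    field_simp
    ring
  · rw [hint]
    rw [hw, hM]
    field_simp
    ring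
  · rw [ae_add_measure_iff]
    constructor
    · refine Measure.ae_smul_measure ?_ _
      rw [ae_dirac_iff measurableSet_Iic]
      exact hM0
    · refine Measure.ae_smul_measure ?_ _
      rw [ae_dirac_iff measurableSet_Iic]

lemma ae_nonneg_of_mem_momentSet {μ σ : ℝ} {P : Measure ℝ} (hP : P ∈ momentSet μ σ) :
    ∀ᵐ s ∂P, 0 ≤ s := by
  rw [ae_iff]
  simp only [not_le]
  exact hP.2.1

variable {n : ℕ} {μv σv : Fin n → ℝ}

lemma map_eval_mem_momentSet (hμ : ∀ i, 0 < μv i) (hσ : ∀ i, 0 < σv i)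
    {P : Measure (Fin n → ℝ)} (hP : P ∈ momentSetN n μv σv) (i : Fin n) :
    P.map (fun s => s i) ∈ momentSet (μv i) (σv i) := by
  obtain ⟨hprob, hneg, hmean, hvar⟩ := hP
  have hm : Measurable fun s : Fin n → ℝ => s i := measurable_pi_apply i
  have hprob' : IsProbabilityMeasure (P.map fun s => s i) :=
    Measure.isProbabilityMeasure_map hm.aemeasurable
  have hmean' : ∫ s, s ∂(P.map fun s => s i) = μv i := by
    rw [integral_map hm.aemeasurable (by fun_prop)]
    exact hmean i
  refine ⟨hprob', ?_, hmean', ?_⟩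
  · rw [Measure.map_apply hm measurableSet_Iio]
    exact hneg i
  · rw [integral_sq_eq_iff (hμ i).ne' (hσ i).ne' hmean',
      integral_map hm.aemeasurable (by fun_prop)]
    exact hvar i

/-- The comonotone coupling of given marginals, realized as nonincreasing functions of a uniform
variable. -/
lemma exists_comonotone_coupling (P : Fin n → Measure ℝ) [∀ i, IsProbabilityMeasure (P i)] :
    ∃ s : Fin n → ℝ → ℝ, ∀ i, AntitoneOn (s i) (Set.Ioo 0 1) ∧
      AEMeasurable (s i) unitVol ∧ unitVol.map (s i) = P i := by
  refine ⟨fun i u => VaR (P i) id (1 - u), fun i => ?_⟩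
  have hmem : ∀ u ∈ Set.Ioo (0 : ℝ) 1, 1 - u ∈ Set.Ioo (0 : ℝ) 1 := fun u hu =>
    ⟨by linarith [hu.2], by linarith [hu.1]⟩
  have hrefl : MeasurePreserving (fun u : ℝ => 1 - u) unitVol unitVol := by
    have := (Measure.measurePreserving_sub_left volume (1 : ℝ)).restrict_preimage
      (measurableSet_Ioo (a := (0 : ℝ)) (b := 1))
    rwa [Set.preimage_const_sub_Ioo, sub_zero, sub_self] at this
  have hq : AEMeasurable (VaR (P i) id) unitVol := aemeasurable_VaR_s13 aemeasurable_id
  refine ⟨fun u hu v hv huv => ?_, hq.comp_quasiMeasurePreserving hrefl.quasiMeasurePreserving, ?_⟩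
  · exact VaR_monotoneOn_s13 aemeasurable_id (hmem v hv) (hmem u hu) (by linarith)
  · have hq' : AEMeasurable (VaR (P i) id) (unitVol.map fun u : ℝ => 1 - u) := by
      rwa [hrefl.map_eq]
    have := AEMeasurable.map_map_of_aemeasurable hq' hrefl.measurable.aemeasurable
    rw [hrefl.map_eq, map_VaR_s13 aemeasurable_id, Measure.map_id] at this
    exact this.symm

lemma map_mem_momentSetN (hμ : ∀ i, 0 < μv i) (hσ : ∀ i, 0 < σv i) {P : Fin n → Measure ℝ}
    (hP : ∀ i, P i ∈ momentSet (μv i) (σv i)) {s : Fin n → ℝ → ℝ}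
    (hs : ∀ i, AEMeasurable (s i) unitVol) (hsP : ∀ i, unitVol.map (s i) = P i) :
    unitVol.map (fun u i => s i u) ∈ momentSetN n μv σv := by
  have hsm : AEMeasurable (fun u i => s i u) unitVol := aemeasurable_pi_iff.2 hs
  have hmap : ∀ i, (unitVol.map (fun u i => s i u)).map (fun t => t i) = P i := by
    intro i
    rw [AEMeasurable.map_map_of_aemeasurable (measurable_pi_apply i).aemeasurable hsm, ← hsP i]
    rfl
  have hm : ∀ i, Measurable fun t : Fin n → ℝ => t i := measurable_pi_apply
  have hcomp : ∀ (i : Fin n) (f : ℝ → ℝ), Measurable f →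
      ∫ t, f (t i) ∂(unitVol.map fun u i => s i u) = ∫ x, f x ∂(P i) := by
    intro i f hf
    rw [← hmap i, integral_map (hm i).aemeasurable hf.aestronglyMeasurable]
  refine ⟨Measure.isProbabilityMeasure_map hsm, fun i => ?_, fun i => ?_, fun i => ?_⟩
  · have := (hP i).2.1
    rwa [← hmap i, Measure.map_apply (hm i) measurableSet_Iio] at this
  · exact (hcomp i _ measurable_id).trans (hP i).2.2.1
  · have := (hP i).1
    rw [hcomp i (fun x => (x - μv i) ^ 2) (by fun_prop)]
    exact (integral_sq_eq_iff (hμ i).ne' (hσ i).ne' (hP i).2.2.1).1 (hP i).2.2.2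

end Moments

section Extrema

variable {ι : Type*} [Fintype ι] {A : ι → Set ℝ} {B : ℝ}

lemma sum_csSup_le (hne : ∀ i, (A i).Nonempty)
    (hB : ∀ f : ι → ℝ, (∀ i, f i ∈ A i) → ∑ i, f i ≤ B) : ∑ i, sSup (A i) ≤ B := by
  refine le_of_forall_pos_sub_le fun ε hε => ?_
  have hδ : 0 < ε / (Fintype.card ι + 1) := by positivity
  choose f hf hlt using fun i => exists_lt_of_lt_csSup (hne i) (sub_lt_self (sSup (A i)) hδ)
  have hsum : ∑ i, sSup (A i) ≤ ∑ i, (f i + ε / (Fintype.card ι + 1)) :=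
    Finset.sum_le_sum fun i _ => by linarith [hlt i]
  rw [Finset.sum_add_distrib, Finset.sum_const, Finset.card_univ, nsmul_eq_mul] at hsum
  have hcard : (Fintype.card ι : ℝ) * (ε / (Fintype.card ι + 1)) ≤ ε := by
    rw [mul_div_assoc', div_le_iff₀ (by positivity)]
    nlinarith
  linarith [hB f hf]

lemma le_sum_csInf (hne : ∀ i, (A i).Nonempty)
    (hB : ∀ f : ι → ℝ, (∀ i, f i ∈ A i) → B ≤ ∑ i, f i) : B ≤ ∑ i, sInf (A i) := by
  have := sum_csSup_le (A := fun i => -A i) (B := -B) (fun i => (hne i).neg) fun f hf => by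
    have := hB (fun i => -f i) hf
    rw [Finset.sum_neg_distrib] at this
    linarith
  simp only [Real.sInf_def, Finset.sum_neg_distrib]
  linarith

end Extrema

section Separability

variable {h : ℝ → ℝ} {p c μ σ x : ℝ}

lemma ae_abs_loss_le (hp : 0 ≤ p) (hc : 0 ≤ c) (hx : 0 ≤ x) {P : Measure ℝ}
    (hP : P ∈ momentSet μ σ) : ∀ᵐ s ∂P, |loss p c x s| ≤ p * x + c * x :=
  (ae_nonneg_of_mem_momentSet hP).mono fun _ hs => abs_loss_le hp hc hx hs

lemma bddAbove_rho_loss (hdist : IsDistortion h) (hconv : ConvexOn ℝ (Set.Icc (0 : ℝ) 1) h)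
    (hp : 0 ≤ p) (hc : 0 ≤ c) (hx : 0 ≤ x) :
    BddAbove ((fun P => rho h P (loss p c x)) '' momentSet μ σ) := by
  refine ⟨(p * x + c * x) * ∫ u, hD h u ∂unitVol, Set.forall_mem_image.2 fun P hP => ?_⟩
  have := hP.1
  exact rho_le hdist hconv (measurable_loss p c x).aemeasurable (ae_abs_loss_le hp hc hx hP)

lemma nonempty_rho_loss (hμ : 0 < μ) :
    ((fun P => rho h P (loss p c x)) '' momentSet μ σ).Nonempty := by
  obtain ⟨P, hP, -⟩ := exists_mem_momentSet (σ := σ) hμ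
  exact ⟨_, Set.mem_image_of_mem _ hP⟩

lemma bddBelow_wcInner (hdist : IsDistortion h) (hconv : ConvexOn ℝ (Set.Icc (0 : ℝ) 1) h)
    (hp : 0 ≤ p) (hc : 0 ≤ c) (hμ : 0 < μ) :
    BddBelow ((fun x => wcInner h p c μ σ x) '' Set.Ici (0 : ℝ)) := by
  obtain ⟨P, hP, M, hM⟩ := exists_mem_momentSet (σ := σ) hμ
  have := hP.1
  refine ⟨-(p * M) * ∫ u, hD h u ∂unitVol, Set.forall_mem_image.2 fun x hx => ?_⟩
  refine le_trans ?_ (le_csSup (bddAbove_rho_loss hdist hconv hp hc hx)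
    (Set.mem_image_of_mem _ hP))
  refine le_rho hdist hconv (measurable_loss p c x).aemeasurable (ae_abs_loss_le hp hc hx hP) ?_
  filter_upwards [hM] with s hs
  exact (neg_le_neg (mul_le_mul_of_nonneg_left hs hp)).trans (neg_mul_le_loss hp hc hx)

variable {n : ℕ} {pv cv μv σv xv : Fin n → ℝ}

lemma rho_sum_loss_le (hdist : IsDistortion h) (hconv : ConvexOn ℝ (Set.Icc (0 : ℝ) 1) h)
    (hp : ∀ i, 0 ≤ pv i) (hc : ∀ i, 0 ≤ cv i) (hμ : ∀ i, 0 < μv i) (hσ : ∀ i, 0 < σv i)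
    (hx : ∀ i, 0 ≤ xv i) {P : Measure (Fin n → ℝ)} (hP : P ∈ momentSetN n μv σv) :
    rho h P (fun s => ∑ i, loss (pv i) (cv i) (xv i) (s i)) ≤
      ∑ i, wcInner h (pv i) (cv i) (μv i) (σv i) (xv i) := by
  have := hP.1
  have hm : ∀ i, Measurable fun s : Fin n → ℝ => s i := measurable_pi_apply
  have hmem := map_eval_mem_momentSet hμ hσ hP
  have hbound : ∀ i, ∀ᵐ s ∂P,
      |loss (pv i) (cv i) (xv i) (s i)| ≤ pv i * xv i + cv i * xv i := fun i =>
    ae_of_ae_map (hm i).aemeasurable (ae_abs_loss_le (hp i) (hc i) (hx i) (hmem i))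
  refine (rho_sum_le hdist hconv (fun i => ((measurable_loss _ _ _).comp (hm i)).aemeasurable)
    hbound).trans (Finset.sum_le_sum fun i _ => ?_)
  refine (rho_map (hm i).aemeasurable (measurable_loss _ _ _)).symm.trans_le ?_
  exact le_csSup (bddAbove_rho_loss hdist hconv (hp i) (hc i) (hx i))
    (Set.mem_image_of_mem _ (hmem i))

/-- Marginal laws can be coupled so that the risk of the total loss is the sum of the risks. -/
lemma exists_coupling_rho_eq (hdist : IsDistortion h)
    (hp : ∀ i, 0 ≤ pv i) (hc : ∀ i, 0 ≤ cv i) (hμ : ∀ i, 0 < μv i) (hσ : ∀ i, 0 < σv i)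
    (hx : ∀ i, 0 ≤ xv i) {P : Fin n → Measure ℝ} (hP : ∀ i, P i ∈ momentSet (μv i) (σv i)) :
    ∃ Q ∈ momentSetN n μv σv, rho h Q (fun s => ∑ i, loss (pv i) (cv i) (xv i) (s i)) =
      ∑ i, rho h (P i) (loss (pv i) (cv i) (xv i)) := by
  have := fun i => (hP i).1
  obtain ⟨s, hs⟩ := exists_comonotone_coupling P
  have hsm : AEMeasurable (fun u i => s i u) unitVol := aemeasurable_pi_iff.2 fun i => (hs i).2.1
  refine ⟨_, map_mem_momentSetN hμ hσ hP (fun i => (hs i).2.1) fun i => (hs i).2.2, ?_⟩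
  have hm : Measurable fun t : Fin n → ℝ => ∑ i, loss (pv i) (cv i) (xv i) (t i) :=
    Finset.measurable_fun_sum _ fun i _ => (measurable_loss _ _ _).comp (measurable_pi_apply i)
  rw [rho_map hsm hm]
  rw [rho_unitVol_sum hdist (G := fun i u => loss (pv i) (cv i) (xv i) (s i u))
    (C := fun i => pv i * xv i + cv i * xv i)
    (fun i u hu v hv huv => loss_antitone (hp i) _ _ ((hs i).1 hu hv huv)) fun i => ?_]
  · refine Finset.sum_congr rfl fun i _ => ?_
    rw [← rho_map (hs i).2.1 (measurable_loss _ _ _), (hs i).2.2]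
  · refine ae_of_ae_map
      (p := fun y => |loss (pv i) (cv i) (xv i) y| ≤ pv i * xv i + cv i * xv i) (hs i).2.1 ?_
    rw [(hs i).2.2]
    exact ae_abs_loss_le (hp i) (hc i) (hx i) (hP i)

lemma wcInnerN_eq_sum (hdist : IsDistortion h) (hconv : ConvexOn ℝ (Set.Icc (0 : ℝ) 1) h)
    (hp : ∀ i, 0 ≤ pv i) (hc : ∀ i, 0 ≤ cv i) (hμ : ∀ i, 0 < μv i) (hσ : ∀ i, 0 < σv i)
    (hx : ∀ i, 0 ≤ xv i) :
    wcInnerN n h pv cv μv σv xv = ∑ i, wcInner h (pv i) (cv i) (μv i) (σv i) (xv i) := by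
  have hub : ∀ y ∈ (fun P : Measure (Fin n → ℝ) =>
      rho h P (fun s => ∑ i, loss (pv i) (cv i) (xv i) (s i))) '' momentSetN n μv σv,
      y ≤ ∑ i, wcInner h (pv i) (cv i) (μv i) (σv i) (xv i) :=
    Set.forall_mem_image.2 fun P hP => rho_sum_loss_le hdist hconv hp hc hμ hσ hx hP
  refine le_antisymm (csSup_le ?_ hub) ?_
  · choose P hP _ using fun i => exists_mem_momentSet (σ := σv i) (hμ i)
    obtain ⟨Q, hQ, -⟩ := exists_coupling_rho_eq hdist hp hc hμ hσ hx hP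
    exact ⟨_, Set.mem_image_of_mem _ hQ⟩
  · refine sum_csSup_le (fun i => nonempty_rho_loss (hμ i)) fun f hf => ?_
    choose P hP hPf using hf
    obtain ⟨Q, hQ, hQeq⟩ := exists_coupling_rho_eq hdist hp hc hμ hσ hx hP
    refine (Finset.sum_congr rfl fun i _ => (hPf i).symm).trans_le ?_
    exact hQeq.symm.trans_le (le_csSup ⟨_, hub⟩ (Set.mem_image_of_mem _ hQ))

lemma wcRiskN_eq_sum (hdist : IsDistortion h) (hconv : ConvexOn ℝ (Set.Icc (0 : ℝ) 1) h)
    (hp : ∀ i, 0 ≤ pv i) (hc : ∀ i, 0 ≤ cv i) (hμ : ∀ i, 0 < μv i) (hσ : ∀ i, 0 < σv i) :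
    wcRiskN n h pv cv μv σv = ∑ i, wcRisk h (pv i) (cv i) (μv i) (σv i) := by
  have hlb : ∀ y ∈ (fun xv => wcInnerN n h pv cv μv σv xv) '' {xv : Fin n → ℝ | ∀ i, 0 ≤ xv i},
      ∑ i, wcRisk h (pv i) (cv i) (μv i) (σv i) ≤ y := by
    refine Set.forall_mem_image.2 fun xv hx => ?_
    rw [wcInnerN_eq_sum hdist hconv hp hc hμ hσ hx]
    exact Finset.sum_le_sum fun i _ => csInf_le
      (bddBelow_wcInner hdist hconv (hp i) (hc i) (hμ i)) (Set.mem_image_of_mem _ (hx i))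
  refine le_antisymm ?_ (le_csInf ⟨_, 0, fun i => le_rfl, rfl⟩ hlb)
  refine le_sum_csInf (fun i => ⟨_, Set.mem_image_of_mem _ Set.self_mem_Ici⟩) fun f hf => ?_
  choose xv hx hxf using hf
  refine (csInf_le ⟨_, hlb⟩ (Set.mem_image_of_mem _ hx)).trans_eq ?_
  exact (wcInnerN_eq_sum hdist hconv hp hc hμ hσ hx).trans (Finset.sum_congr rfl fun i _ => hxf i)

end Separability

end NV

/-- Multi-product separability (Theorem 2). -/
theorem stmt13 (n : ℕ) (hn : 0 < n)
    (h : ℝ → ℝ) (hdist : IsDistortion h) (hconv : ConvexOn ℝ (Set.Icc (0 : ℝ) 1) h)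
    (pv cv μv σv : Fin n → ℝ)
    (hpc : ∀ i, 0 < cv i ∧ cv i < pv i) (hμ : ∀ i, 0 < μv i) (hσ : ∀ i, 0 < σv i) :
    NV.wcRiskN n h pv cv μv σv = ∑ i, wcRisk h (pv i) (cv i) (μv i) (σv i) ∧
    ∀ xv : Fin n → ℝ,
      (∀ i, 0 ≤ xv i ∧
        wcInner h (pv i) (cv i) (μv i) (σv i) (xv i) = wcRisk h (pv i) (cv i) (μv i) (σv i)) →
      NV.wcInnerN n h pv cv μv σv xv = NV.wcRiskN n h pv cv μv σv := by
  have hp : ∀ i, 0 ≤ pv i := fun i => ((hpc i).1.trans (hpc i).2).le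
  have hc : ∀ i, 0 ≤ cv i := fun i => (hpc i).1.le
  refine ⟨wcRiskN_eq_sum hdist hconv hp hc hμ hσ, fun xv hxv => ?_⟩
  rw [wcInnerN_eq_sum hdist hconv hp hc hμ hσ fun i => (hxv i).1,
    wcRiskN_eq_sum hdist hconv hp hc hμ hσ]
  exact Finset.sum_congr rfl fun i _ => (hxv i).2
end
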